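/- arXiv:1110.5942 — 3 statements merged into one kernel-verified Lean document; each statement's English description precedes it below -/
import Mathlib

section
/- Let A = (Σ, Q, Q₀, Δ, F) be a nondeterministic Büchi automaton, w : ℕ → Σ an infinite word, and define the subset-construction run ρ̃ : ℕ → 2^Q by ρ̃(0) = Q₀ and ρ̃(i+1) = { q' ∈ Q ∣ ∃ q ∈ ρ̃(i), (q, w(i), q') ∈ Δ }. Suppose there is a strictly increasing sequence of indices i₀ < i₁ < i₂ < ⋯ such that ρ̃(i_m) ≠ ∅ for every m, and for every m and every state q' ∈ ρ̃(i_{m+1}) there exist a state q ∈ ρ̃(i_m) and a finite run of A from q to q' over the finite word w(i_m) w(i_m+1) ⋯ w(i_{m+1}−1) that visits F. Then there exists a run ρ of A over w such that Inf(ρ) ∩ F ≠ ∅ (i.e., ρ is accepting) and ρ(i) ∈ ρ̃(i) for every i ∈ ℕ. -/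
/-- The set of states occurring infinitely often in an infinite run. -/
def InfStates {Q : Type*} (ρ : ℕ → Q) : Set Q :=
  {q | ∀ N : ℕ, ∃ m : ℕ, N ≤ m ∧ ρ m = q}

/-- Safra's connecting lemma for Büchi automata (Lemma 1): if the
subset-construction run `ρt` admits a strictly increasing sequence of indices
along which consecutive subsets are connected by finite runs visiting `F`,
then there is an accepting run of the Büchi automaton tracked by `ρt`. -/
theorem buchi_connecting_dots
    {α Q : Type*} [Fintype α] [Nonempty α] [Fintype Q]
    (Q₀ : Set Q) (Δ : Q → α → Q → Prop) (F : Set Q)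
    (w : ℕ → α)
    (ρt : ℕ → Set Q)
    (hρt0 : ρt 0 = Q₀)
    (hρts : ∀ i : ℕ, ρt (i + 1) = {q' | ∃ q ∈ ρt i, Δ q (w i) q'})
    (idx : ℕ → ℕ) (hidx : StrictMono idx)
    (hne : ∀ m : ℕ, (ρt (idx m)).Nonempty)
    (hconn : ∀ m : ℕ, ∀ q' ∈ ρt (idx (m + 1)), ∃ q ∈ ρt (idx m),
      ∃ σ : ℕ → Q, σ 0 = q ∧ σ (idx (m + 1) - idx m) = q' ∧
        (∀ j < idx (m + 1) - idx m, Δ (σ j) (w (idx m + j)) (σ (j + 1))) ∧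
        (∃ j ≤ idx (m + 1) - idx m, σ j ∈ F)) :
    ∃ ρ : ℕ → Q, ρ 0 ∈ Q₀ ∧ (∀ i : ℕ, Δ (ρ i) (w i) (ρ (i + 1))) ∧
      (InfStates ρ ∩ F).Nonempty ∧ (∀ i : ℕ, ρ i ∈ ρt i) := by
  classical
  let : TopologicalSpace Q := ⊥
  have : DiscreteTopology Q := ⟨rfl⟩
  have hbase : ∀ n : ℕ, ∀ q ∈ ρt n, ∃ ρ : ℕ → Q, ρ 0 ∈ Q₀ ∧
      (∀ i < n, Δ (ρ i) (w i) (ρ (i + 1))) ∧ ρ n = q := by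
    intro n
    induction n with
    | zero =>
      intro q hq
      exact ⟨fun _ => q, hρt0 ▸ hq, fun i hi => absurd hi (Nat.not_lt_zero i), rfl⟩
    | succ n ih =>
      intro q hq
      rw [hρts] at hq
      obtain ⟨p, hp, hpq⟩ := hq
      obtain ⟨ρ, h0, h1, h2⟩ := ih p hp
      refine ⟨fun i => if i ≤ n then ρ i else q, by simpa using h0, ?_, by simp⟩
      intro i hi
      rcases Nat.lt_or_ge i n with h | h
      · have a : i ≤ n := h.le
        have b : i + 1 ≤ n := h
        simpa [a, b] using h1 i h
      · have : i = n := by omega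
        subst this
        simpa [h2] using hpq
  have hstep : ∀ m : ℕ, ∀ q ∈ ρt (idx m), ∃ ρ : ℕ → Q, ρ 0 ∈ Q₀ ∧
      (∀ i < idx m, Δ (ρ i) (w i) (ρ (i + 1))) ∧
      (∀ k < m, ∃ j ∈ Set.Icc (idx k) (idx (k + 1)), ρ j ∈ F) ∧ ρ (idx m) = q := by
    intro m
    induction m with
    | zero =>
      intro q hq
      obtain ⟨ρ, h0, h1, h2⟩ := hbase _ q hq
      exact ⟨ρ, h0, h1, fun k hk => absurd hk (Nat.not_lt_zero k), h2⟩
    | succ m ih =>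
      intro q hq
      obtain ⟨p, hp, σ, s0, s1, s2, j, hj, hjF⟩ := hconn m q hq
      obtain ⟨ρ, h0, h1, h2, h3⟩ := ih p hp
      have hlt : idx m < idx (m + 1) := hidx (Nat.lt_succ_self m)
      let τ : ℕ → Q := fun i => if i ≤ idx m then ρ i else σ (i - idx m)
      have t1 : ∀ i ≤ idx m, τ i = ρ i := fun i hi => by simp [τ, hi]
      have t2 : ∀ d, τ (idx m + d) = σ d := by
        intro d
        rcases Nat.eq_zero_or_pos d with rfl | hd
        · simp [τ, h3, s0]
        · have : ¬ (idx m + d ≤ idx m) := by omega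
          simp only [τ, if_neg this, Nat.add_sub_cancel_left]
      refine ⟨τ, by rw [t1 0 (Nat.zero_le _)]; exact h0, ?_, ?_, ?_⟩
      · intro i hi
        rcases Nat.lt_or_ge i (idx m) with h | h
        · rw [t1 i h.le, t1 (i + 1) h]
          exact h1 i h
        · obtain ⟨d, rfl⟩ := Nat.exists_eq_add_of_le h
          rw [add_assoc, t2, t2]
          exact s2 d (by omega)
      · intro k hk
        rcases Nat.lt_or_ge k m with h | h
        · obtain ⟨l, hl, hlF⟩ := h2 k h
          have : idx (k + 1) ≤ idx m := hidx.monotone h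
          exact ⟨l, hl, by rw [t1 l (hl.2.trans this)]; exact hlF⟩
        · have : k = m := by omega
          subst this
          exact ⟨idx k + j, ⟨by omega, by omega⟩, by rw [t2]; exact hjF⟩
      · obtain ⟨d, hd⟩ := Nat.exists_eq_add_of_le hlt.le
        rw [hd, t2, ← s1, hd, Nat.add_sub_cancel_left]
  let K : ℕ → Set (ℕ → Q) := fun m => {ρ | ρ 0 ∈ Q₀ ∧
      (∀ i < idx m, Δ (ρ i) (w i) (ρ (i + 1))) ∧
      (∀ k < m, ∃ j ∈ Set.Icc (idx k) (idx (k + 1)), ρ j ∈ F)}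
  have hcl : ∀ m, IsClosed (K m) := by
    intro m
    have c0 : IsClosed {ρ : ℕ → Q | ρ 0 ∈ Q₀} :=
      (isClosed_discrete Q₀).preimage (continuous_apply 0)
    have c1 : IsClosed {ρ : ℕ → Q | ∀ i < idx m, Δ (ρ i) (w i) (ρ (i + 1))} := by
      simp only [Set.ofPred_forall]
      refine isClosed_iInter fun i => isClosed_iInter fun _ => ?_
      have hc : Continuous (fun ρ : ℕ → Q => (ρ i, ρ (i + 1))) := by fun_prop
      exact (isClosed_discrete {x : Q × Q | Δ x.1 (w i) x.2}).preimage hc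
    have c2 : IsClosed {ρ : ℕ → Q | ∀ k < m, ∃ j ∈ Set.Icc (idx k) (idx (k + 1)), ρ j ∈ F} := by
      simp only [Set.ofPred_forall]
      refine isClosed_iInter fun k => isClosed_iInter fun _ => ?_
      have : {ρ : ℕ → Q | ∃ j ∈ Set.Icc (idx k) (idx (k + 1)), ρ j ∈ F} =
          ⋃ j ∈ Set.Icc (idx k) (idx (k + 1)), {ρ : ℕ → Q | ρ j ∈ F} := by
        ext; simp
      rw [this]
      exact (Set.finite_Icc _ _).isClosed_biUnion fun j _ =>
        (isClosed_discrete F).preimage (continuous_apply j)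
    exact c0.inter (c1.inter c2)
  obtain ⟨ρ, hρ⟩ := IsCompact.nonempty_iInter_of_sequence_nonempty_isCompact_isClosed K
    (fun m ρ h => ⟨h.1, fun i hi => h.2.1 i (hi.trans (hidx (Nat.lt_succ_self m))),
      fun k hk => h.2.2 k (hk.trans (Nat.lt_succ_self m))⟩)
    (fun m => by
      obtain ⟨q, hq⟩ := hne m
      obtain ⟨ρ, a, b, c, _⟩ := hstep m q hq
      exact ⟨ρ, a, b, c⟩)
    (hcl 0).isCompact hcl
  rw [Set.mem_iInter] at hρ
  have hD : ∀ i : ℕ, Δ (ρ i) (w i) (ρ (i + 1)) := fun i =>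
    (hρ (i + 1)).2.1 i (lt_of_lt_of_le (Nat.lt_succ_self i) (hidx.le_apply))
  refine ⟨ρ, (hρ 0).1, hD, ?_, ?_⟩
  · by_contra hcon
    have hb : ∀ q : Q, ∃ N : ℕ, q ∈ F → ∀ m, N ≤ m → ρ m ≠ q := by
      intro q
      by_contra! h
      exact hcon ⟨q, fun N => (h N).2, (h 0).1⟩
    choose N hN using hb
    let M := Finset.univ.sup N
    obtain ⟨j, hj, hjF⟩ := (hρ (M + 1)).2.2 M (Nat.lt_succ_self M)
    have hM : N (ρ j) ≤ M := Finset.le_sup (Finset.mem_univ _)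
    exact hN (ρ j) hjF j (hM.trans (hidx.le_apply.trans hj.1)) rfl
  · intro i
    induction i with
    | zero => rw [hρt0]; exact (hρ 0).1
    | succ i ih => rw [hρts]; exact ⟨ρ i, ih, hD i⟩
end

section
/- Let A = (Σ, Q, Q₀, Δ, ⟨G,B⟩_I) be a nondeterministic Streett automaton with I = {1,…,k}, J ⊆ I, w : ℕ → Σ an infinite word, and define ρ̃ : ℕ → 2^Q by ρ̃(0) = Q₀ and ρ̃(i+1) = { q' ∈ Q ∣ ∃ q ∈ ρ̃(i), (q, w(i), q') ∈ Δ }. Suppose there is a strictly increasing sequence of indices i₀ < i₁ < i₂ < ⋯ such that ρ̃(i_m) ≠ ∅ for every m, and for every m and every state q' ∈ ρ̃(i_{m+1}) there exist a state q ∈ ρ̃(i_m) and a finite run of A from q to q' over the finite word w(i_m) w(i_m+1) ⋯ w(i_{m+1}−1) that fulfills J (i.e., it visits B(j) for every j ∈ J and never visits G(j) for any j ∈ I∖J). Then there exists a Streett-accepting run ρ of A over w such that ρ(i) ∈ ρ̃(i) for every i ∈ ℕ. -/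
theorem scd_prefix {α Q : Type*} (Q₀ : Set Q) (Δ : Q → α → Q → Prop) (w : ℕ → α)
    (ρt : ℕ → Set Q) (hρt0 : ρt 0 = Q₀)
    (hρts : ∀ i : ℕ, ρt (i + 1) = {q' | ∃ q ∈ ρt i, Δ q (w i) q'}) (n : ℕ) :
    ∀ q ∈ ρt n, ∃ ρ : ℕ → Q, ρ 0 ∈ Q₀ ∧ (∀ i < n, Δ (ρ i) (w i) (ρ (i + 1))) ∧ ρ n = q := by
  induction n with
  | zero => intro q hq; exact ⟨fun _ => q, hρt0 ▸ hq, by simp, rfl⟩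
  | succ n ih =>
    intro q hq
    rw [hρts] at hq
    obtain ⟨p, hp, hd⟩ := hq
    obtain ⟨ρ, h0, h1, h2⟩ := ih p hp
    refine ⟨fun i => if i ≤ n then ρ i else q, by simpa using h0, ?_, by simp⟩
    intro i hi
    rcases Nat.lt_or_ge i n with h | h
    · simpa [h.le, Nat.succ_le_of_lt h] using h1 i h
    · obtain rfl : i = n := by omega
      simpa [h2] using hd

def scdGood {α Q : Type*} {k : ℕ} (Q₀ : Set Q) (Δ : Q → α → Q → Prop) (G B : Fin k → Set Q)
    (J : Set (Fin k)) (w : ℕ → α) (idx : ℕ → ℕ) (m : ℕ) : Set (ℕ → Q) :=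
  {ρ | ρ 0 ∈ Q₀ ∧ (∀ i < idx m, Δ (ρ i) (w i) (ρ (i + 1))) ∧
    (∀ l < m, ∀ j ∈ J, ∃ p ∈ Set.Icc (idx l) (idx (l+1)), ρ p ∈ B j) ∧
    (∀ j ∉ J, ∀ p, idx 0 < p → p ≤ idx m → ρ p ∉ G j)}

theorem scdGood_closed {α Q : Type*} [TopologicalSpace Q] [DiscreteTopology Q]
    {k : ℕ} (Q₀ : Set Q) (Δ : Q → α → Q → Prop) (G B : Fin k → Set Q)
    (J : Set (Fin k)) (w : ℕ → α) (idx : ℕ → ℕ) (m : ℕ) :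
    IsClosed (scdGood Q₀ Δ G B J w idx m) := by
  have key : ∀ (p : ℕ) (S : Set Q), IsClosed {ρ : ℕ → Q | ρ p ∈ S} := fun p S =>
    (isClosed_discrete S).preimage (continuous_apply p)
  have key2 : ∀ i, IsClosed {ρ : ℕ → Q | Δ (ρ i) (w i) (ρ (i + 1))} := fun i => by
    have hc : Continuous (fun ρ : ℕ → Q => (ρ i, ρ (i+1))) :=
      (continuous_apply i).prodMk (continuous_apply (i+1))
    have := (isClosed_discrete {x : Q × Q | Δ x.1 (w i) x.2}).preimage hc
    exact this
  unfold scdGood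
  simp only [Set.ofPred_and, Set.ofPred_forall]
  refine (key 0 Q₀).inter (IsClosed.inter ?_ (IsClosed.inter ?_ ?_))
  · exact isClosed_iInter fun i => isClosed_iInter fun _ => key2 i
  · refine isClosed_iInter fun l => isClosed_iInter fun _ => isClosed_iInter fun j =>
      isClosed_iInter fun _ => ?_
    have := (Set.finite_Icc (idx l) (idx (l+1))).isClosed_biUnion (fun p _ => key p (B j))
    convert this using 1
    ext ρ
    simp
  · exact isClosed_iInter fun j => isClosed_iInter fun _ => isClosed_iInter fun p =>
      isClosed_iInter fun _ => isClosed_iInter fun _ => key p (G j)ᶜ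

/-- Safra's connecting lemma for Streett automata (Lemma 2): if the
subset-construction run `ρt` admits a strictly increasing sequence of indices
along which consecutive subsets are connected by finite runs fulfilling the
witness set `J` (visiting `B j` for every `j ∈ J` and never visiting `G j`
for `j ∉ J`), then there is a Streett-accepting run tracked by `ρt`. -/
theorem streett_connecting_dots
    {α Q : Type*} [Fintype α] [Nonempty α] [Fintype Q] {k : ℕ}
    (Q₀ : Set Q) (Δ : Q → α → Q → Prop) (G B : Fin k → Set Q)
    (J : Set (Fin k))
    (w : ℕ → α)
    (ρt : ℕ → Set Q)
    (hρt0 : ρt 0 = Q₀)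
    (hρts : ∀ i : ℕ, ρt (i + 1) = {q' | ∃ q ∈ ρt i, Δ q (w i) q'})
    (idx : ℕ → ℕ) (hidx : StrictMono idx)
    (hne : ∀ m : ℕ, (ρt (idx m)).Nonempty)
    (hconn : ∀ m : ℕ, ∀ q' ∈ ρt (idx (m + 1)), ∃ q ∈ ρt (idx m),
      ∃ σ : ℕ → Q, σ 0 = q ∧ σ (idx (m + 1) - idx m) = q' ∧
        (∀ j < idx (m + 1) - idx m, Δ (σ j) (w (idx m + j)) (σ (j + 1))) ∧
        (∀ j ∈ J, ∃ p ≤ idx (m + 1) - idx m, σ p ∈ B j) ∧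
        (∀ j ∉ J, ∀ p ≤ idx (m + 1) - idx m, σ p ∉ G j)) :
    ∃ ρ : ℕ → Q, ρ 0 ∈ Q₀ ∧ (∀ i : ℕ, Δ (ρ i) (w i) (ρ (i + 1))) ∧
      (∀ i : Fin k, (InfStates ρ ∩ G i).Nonempty → (InfStates ρ ∩ B i).Nonempty) ∧
      (∀ i : ℕ, ρ i ∈ ρt i) := by
  have hmem : ∀ m, ∀ q ∈ ρt (idx m), ∃ ρ ∈ scdGood Q₀ Δ G B J w idx m, ρ (idx m) = q := by
    intro m
    induction m with
    | zero =>
      intro q hq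
      obtain ⟨ρ, h0, h1, h2⟩ := scd_prefix Q₀ Δ w ρt hρt0 hρts _ q hq
      exact ⟨ρ, ⟨h0, h1, by simp, fun j _ p h h' => by omega⟩, h2⟩
    | succ m ih =>
      intro q' hq'
      obtain ⟨q, hq, σ, hs0, hs1, hsd, hsB, hsG⟩ := hconn m q' hq'
      obtain ⟨ρ, ⟨h0, h1, h2, h3⟩, h4⟩ := ih q hq
      have hlt : idx m < idx (m+1) := hidx (Nat.lt_succ_self m)
      set τ : ℕ → Q := fun i => if i ≤ idx m then ρ i else σ (i - idx m) with hτ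
      have ta : ∀ i ≤ idx m, τ i = ρ i := fun i hi => by simp [hτ, hi]
      have tb : ∀ i, idx m ≤ i → τ i = σ (i - idx m) := fun i hi => by
        rcases hi.eq_or_lt with h | h
        · subst h; simp [hτ, h4, hs0]
        · simp [hτ, Nat.not_le.mpr h]
      refine ⟨τ, ⟨?_, ?_, ?_, ?_⟩, ?_⟩
      · rw [ta 0 (Nat.zero_le _)]; exact h0
      · intro i hi
        rcases Nat.lt_or_ge i (idx m) with h | h
        · rw [ta i h.le, ta (i+1) h]; exact h1 i h
        · rw [tb i h, tb (i+1) (by omega)]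
          have := hsd (i - idx m) (by omega)
          rwa [show idx m + (i - idx m) = i by omega,
            show i - idx m + 1 = i + 1 - idx m by omega] at this
      · intro l hl j hj
        rcases Nat.lt_or_ge l m with h | h
        · obtain ⟨p, hp, hpB⟩ := h2 l h j hj
          refine ⟨p, hp, ?_⟩
          rw [ta p (hp.2.trans (hidx.monotone h))]; exact hpB
        · obtain rfl : l = m := by omega
          obtain ⟨p, hp, hpB⟩ := hsB j hj
          refine ⟨idx l + p, ⟨by omega, by omega⟩, ?_⟩
          rw [tb _ (by omega), Nat.add_sub_cancel_left]; exact hpB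
      · intro j hj p hp hp'
        rcases Nat.le_total p (idx m) with h | h
        · rw [ta p h]; exact h3 j hj p hp h
        · rw [tb p h]; exact hsG j hj _ (by omega)
      · rw [tb _ hlt.le]; exact hs1
  letI : TopologicalSpace Q := ⊥
  haveI : DiscreteTopology Q := ⟨rfl⟩
  haveI : Finite Q := inferInstance
  have hcl := scdGood_closed Q₀ Δ G B J w idx
  obtain ⟨ρ, hρ⟩ := IsCompact.nonempty_iInter_of_sequence_nonempty_isCompact_isClosed
    (scdGood Q₀ Δ G B J w idx)
    (fun m ρ ⟨h0, h1, h2, h3⟩ => ⟨h0,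
      fun i hi => h1 i (hi.trans (hidx (Nat.lt_succ_self m))),
      fun l hl => h2 l (by omega),
      fun j hj p hp hp' => h3 j hj p hp (hp'.trans (hidx (Nat.lt_succ_self m)).le)⟩)
    (fun m => by
      obtain ⟨q, hq⟩ := hne m
      obtain ⟨ρ, h, _⟩ := hmem m q hq
      exact ⟨ρ, h⟩)
    (hcl 0).isCompact hcl
  rw [Set.mem_iInter] at hρ
  have hd : ∀ i : ℕ, Δ (ρ i) (w i) (ρ (i + 1)) := fun i =>
    (hρ (i+1)).2.1 i (hidx.id_le (i+1))
  refine ⟨ρ, (hρ 0).1, hd, ?_, ?_⟩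
  · intro j ⟨q, hqi, hqG⟩
    by_cases hj : j ∈ J
    · by_contra hno
      have : ∀ q : Q, ∃ N, q ∈ B j → ∀ m, N ≤ m → ρ m ≠ q := by
        intro q
        by_cases hq : q ∈ B j
        · have : q ∉ InfStates ρ := fun h => hno ⟨q, h, hq⟩
          simp only [InfStates, Set.mem_ofPred_eq] at this
          push Not at this
          obtain ⟨N, hN⟩ := this
          exact ⟨N, fun _ => hN⟩
        · exact ⟨0, fun h => absurd h hq⟩
      choose N hN using this
      let M := Finset.univ.sup N
      obtain ⟨p, hp, hpB⟩ := (hρ (M+1)).2.2.1 M (Nat.lt_succ_self M) j hj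
      have h1 : N (ρ p) ≤ M := Finset.le_sup (Finset.mem_univ _)
      exact hN (ρ p) hpB p (h1.trans ((hidx.id_le M).trans hp.1)) rfl
    · obtain ⟨m, hm, rfl⟩ := hqi (idx 0 + 1)
      exact absurd hqG ((hρ m).2.2.2 j hj m hm (hidx.id_le m))
  · intro i
    induction i with
    | zero => rw [hρt0]; exact (hρ 0).1
    | succ i ih => rw [hρts]; exact ⟨ρ i, ih, hd i⟩
end

section
/- There exists n₀ ∈ ℕ such that for every nondeterministic Streett automaton A with n ≥ n₀ states and any index size k ≥ 1, there exists a deterministic Rabin automaton B over the same alphabet with L(B) = L(A), whose number of states is at most 2^{12n}·(0.37·n)^{n²+8n} and whose index size is at most n·(min(n,k)+1). -/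
namespace SD

abbrev Code := List (ℕ × ℕ)

structure Skel (Q : Type) where
  r : Finset Q → ℕ
  β : Finset Q → ℕ → Finset Q
  nx : Finset Q → ℕ → Finset Q
  dep : Finset Q → ℕ
  nx_zero : ∀ S, nx S 0 = S
  nx_sub : ∀ S j, nx S j ⊆ S
  dep_lt : ∀ S j, j ≠ 0 → j ≤ r S → dep (nx S j) < dep S

variable {Q : Type}

def zext (K : Skel Q) (S : Finset Q) : Code :=
  if _h : K.r S = 0 then [] else (K.r S, 0) :: zext K (K.nx S (K.r S))
termination_by K.dep S
decreasing_by exact K.dep_lt S _ _h le_rfl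

def sat (K : Skel Q) : Finset Q → Code → Finset Q
  | S, [] => S
  | S, e :: l => sat K (K.nx S e.1) l

def valid (K : Skel Q) : Finset Q → Code → Prop
  | S, [] => K.r S = 0
  | S, e :: l => K.r S ≠ 0 ∧ e.1 ≤ K.r S ∧ valid K (K.nx S e.1) l

open Classical in
noncomputable def trans (K : Skel Q) (q : Q) (ν : ℕ) : Finset Q → Code → Code
  | _, [] => []
  | S, e :: l => if q ∈ K.nx S e.1 then e :: trans K q ν (K.nx S e.1) l else
      ((if q ∈ K.β S e.1 then e.1 - 1 else e.1), ν) ::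
        zext K (K.nx S (if q ∈ K.β S e.1 then e.1 - 1 else e.1))

lemma sat_append (K : Skel Q) (S : Finset Q) (u v : Code) :
    sat K S (u ++ v) = sat K (sat K S u) v := by
  induction u generalizing S with
  | nil => rfl
  | cons e u ih => simp [sat, ih]

lemma valid_append (K : Skel Q) (S : Finset Q) (u v : Code) (h : valid K S (u ++ v)) :
    valid K (sat K S u) v := by
  induction u generalizing S with
  | nil => exact h
  | cons e u ih => exact ih _ h.2.2

lemma valid_replace (K : Skel Q) (S : Finset Q) (u v v' : Code) (h : valid K S (u ++ v))
    (h' : valid K (sat K S u) v') : valid K S (u ++ v') := by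
  induction u generalizing S with
  | nil => exact h'
  | cons e u ih => exact ⟨h.1, h.2.1, ih _ h.2.2 h'⟩

lemma sat_sub (K : Skel Q) (S : Finset Q) (u : Code) : sat K S u ⊆ S := by
  induction u generalizing S with
  | nil => exact Finset.Subset.refl _
  | cons e u ih => exact (ih _).trans (K.nx_sub _ _)

lemma zext_spec (K : Skel Q) (S : Finset Q) :
    valid K S (zext K S) ∧ ∀ e ∈ zext K S, e.2 = 0 ∧ e.1 ≠ 0 := by
  induction' hd : K.dep S using Nat.strong_induction_on with d ih generalizing S
  rw [zext]
  split_ifs with h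
  · simp [valid, h]
  · subst hd
    have := ih _ (K.dep_lt S _ h le_rfl) _ rfl
    refine ⟨⟨h, le_rfl, this.1⟩, ?_⟩
    intro e he
    rcases List.mem_cons.1 he with rfl | he
    · exact ⟨rfl, h⟩
    · exact this.2 e he

lemma zext_head (K : Skel Q) (S : Finset Q) (h : K.r S ≠ 0) :
    ∃ l, zext K S = (K.r S, 0) :: l := by
  rw [zext, dif_neg h]; exact ⟨_, rfl⟩

lemma valid_trans (K : Skel Q) (q : Q) (ν : ℕ) (S : Finset Q) (l : Code) (h : valid K S l) :
    valid K S (trans K q ν S l) := by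
  induction l generalizing S with
  | nil => exact h
  | cons e l ih =>
    rw [trans]
    split_ifs with h1 h2
    · exact ⟨h.1, h.2.1, ih _ h.2.2⟩
    · exact ⟨h.1, (Nat.sub_le _ _).trans h.2.1, (zext_spec K _).1⟩
    · exact ⟨h.1, h.2.1, (zext_spec K _).1⟩

/-- unaffected prefix -/
lemma trans_append (K : Skel Q) (q : Q) (ν : ℕ) (S : Finset Q) (u v : Code)
    (h : q ∈ sat K S u) : trans K q ν S (u ++ v) = u ++ trans K q ν (sat K S u) v := by
  induction u generalizing S with
  | nil => rfl
  | cons e u ih =>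
    have h1 : q ∈ K.nx S e.1 := sat_sub K _ u h
    rw [List.cons_append, trans, if_pos h1, ih _ h]; rfl

lemma trans_cases (K : Skel Q) (q : Q) (ν : ℕ) (S : Finset Q) (l : Code) (hS : q ∈ S) :
    (trans K q ν S l = l ∧ q ∈ sat K S l) ∨ ∃ u e v j, l = u ++ e :: v ∧ q ∈ sat K S u ∧
      trans K q ν S l = u ++ (j, ν) :: zext K (K.nx (sat K S u) j) := by
  induction l generalizing S with
  | nil => left; exact ⟨rfl, hS⟩
  | cons e l ih =>
    by_cases h1 : q ∈ K.nx S e.1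
    · rw [trans, if_pos h1]
      rcases ih _ h1 with ⟨h, h'⟩ | ⟨u, e', v, j, h2, h3, h4⟩
      · left; exact ⟨by rw [h], h'⟩
      · right; exact ⟨e :: u, e', v, j, by rw [h2]; rfl, h3, by rw [h4]; rfl⟩
    · right
      have h2 := trans.eq_2 K q ν S e l
      rw [if_neg h1] at h2
      exact ⟨[], e, l, _, rfl, hS, h2⟩

/-- old prefixes -/
lemma trans_old (K : Skel Q) (q : Q) (ν N : ℕ) (hν : N ≤ ν) (S : Finset Q) (l p : Code)
    (hS : q ∈ S) (hp : p <+: trans K q ν S l) (hN : ∀ e ∈ p, e.2 < N) :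
    p <+: l ∧ q ∈ sat K S p := by
  have key : ∀ w : Code, p <+: w → q ∈ sat K S w → q ∈ sat K S p := by
    rintro w ⟨t, rfl⟩ h
    rw [sat_append] at h
    exact sat_sub K _ _ h
  rcases trans_cases K q ν S l hS with ⟨h, h'⟩ | ⟨u, e, v, j, rfl, h3, h4⟩
  · rw [h] at hp
    exact ⟨hp, key _ hp h'⟩
  · rw [h4] at hp
    have : p <+: u := by
      have h5 : u <+: u ++ (j, ν) :: zext K (K.nx (sat K S u) j) := List.prefix_append _ _
      rcases List.prefix_or_prefix_of_prefix hp h5 with h | ⟨t, rfl⟩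
      · exact h
      · rw [List.prefix_append_right_inj] at hp
        cases t with
        | nil => simp
        | cons a t =>
          rw [List.cons_prefix_cons] at hp
          have := hN a (by simp)
          rw [hp.1] at this; simp at this; omega
    exact ⟨this.trans (List.prefix_append _ _), key _ this h3⟩

/-- stamps in trans -/
lemma trans_new (K : Skel Q) (q : Q) (ν N : ℕ) (S : Finset Q) (l u : Code) (e : ℕ × ℕ)
    (hS : q ∈ S) (hl : ∀ e ∈ l, e.2 < N) (hp : u ++ [e] <+: trans K q ν S l) :
    (∀ x ∈ u ++ [e], x.2 < N) ∨ ((∀ x ∈ u, x.2 < N) ∧ e.2 = ν) ∨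
    ((∃ x ∈ u, x.2 = ν) ∧ e.2 = 0 ∧ e.1 ≠ 0) := by
  rcases trans_cases K q ν S l hS with ⟨h, h'⟩ | ⟨w, e', v, j, rfl, h3, h4⟩
  · rw [h] at hp
    left; intro x hx; exact hl x (hp.subset hx)
  · rw [h4] at hp
    have h5 : w <+: w ++ (j, ν) :: zext K (K.nx (sat K S w) j) := List.prefix_append _ _
    rcases List.prefix_or_prefix_of_prefix hp h5 with h | ⟨t, ht⟩
    · left; intro x hx
      exact hl x (List.mem_append_left _ (h.subset hx))
    · rw [← ht, List.prefix_append_right_inj] at hp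
      rcases List.eq_nil_or_concat t with rfl | ⟨t, e2, rfl⟩
      · left; intro x hx
        exact hl x (List.mem_append_left _ (by rw [← List.append_nil w, ht]; exact hx))
      · rw [List.concat_eq_append, ← List.append_assoc] at ht
        obtain ⟨rfl, h6⟩ := List.append_inj' ht rfl
        obtain rfl : e2 = e := by simpa using h6
        right
        rw [List.concat_eq_append] at hp
        cases t with
        | nil =>
          left
          rw [List.nil_append, List.cons_prefix_cons] at hp
          refine ⟨fun x hx => hl x (List.mem_append_left _ (by simpa using hx)), by rw [hp.1]⟩
        | cons a t =>
          right
          rw [List.cons_append, List.cons_prefix_cons] at hp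
          refine ⟨⟨a, by simp, by rw [hp.1]⟩, ?_⟩
          exact (zext_spec K _).2 e2 (hp.2.subset (by simp))

end SD

namespace SD
variable {Q : Type}

abbrev Conf (Q : Type) := Q → Option Code

def nd (f : Conf Q) (p : Code) : Prop := ∃ q l, f q = some l ∧ p <+: l

lemma nd.mono {f : Conf Q} {p p' : Code} (h : nd f p) (h' : p' <+: p) : nd f p' := by
  obtain ⟨q, l, h1, h2⟩ := h
  exact ⟨q, l, h1, h'.trans h2⟩

structure PreInv [Fintype Q] (K : Skel Q) (f : Conf Q) : Prop where
  val : ∀ q l, f q = some l → valid K Finset.univ l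
  uniq : ∀ u e u' e', nd f (u ++ [e]) → nd f (u' ++ [e']) → e.2 = e'.2 → e.2 ≠ 0 →
    u = u' ∧ e = e'
  z1 : ∀ u e, nd f (u ++ [e]) → e.2 = 0 → e.1 ≠ 0
  z2 : ∀ u e e', nd f (u ++ [e]) → nd f (u ++ [e']) → e.2 = 0 → e'.2 = 0 → e = e'

structure Inv [Fintype Q] (K : Skel Q) (N : ℕ) (f : Conf Q) : Prop extends PreInv K f where
  ext : ∀ p, nd f p → ∃ q z, f q = some (p ++ z) ∧ ∀ e ∈ z, e.2 = 0
  lt : ∀ u e, nd f (u ++ [e]) → e.2 < N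

lemma mem_split_prefix {l : Code} {e : ℕ × ℕ} (h : e ∈ l) : ∃ u, u ++ [e] <+: l := by
  obtain ⟨s, t, rfl⟩ := List.append_of_mem h
  exact ⟨s, t, by simp⟩

lemma Inv.lt' [Fintype Q] {K : Skel Q} {N : ℕ} {f : Conf Q} (h : Inv K N f) {q : Q} {l : Code}
    (hl : f q = some l) : ∀ e ∈ l, e.2 < N := by
  intro e he
  obtain ⟨u, hu⟩ := mem_split_prefix he
  exact h.lt u e ⟨q, l, hl, hu⟩

/-! ### successor -/
section F1
variable [Fintype Q] (K : Skel Q) (ν : Q → ℕ) (R : Q → Q → Prop) (f : Conf Q)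

def cand (q' : Q) : Set Code :=
  {c | ∃ q l, R q q' ∧ f q = some l ∧ c = trans K q' (ν q') Finset.univ l}

lemma cand_fin (q' : Q) : (cand K ν R f q').Finite := by
  apply (Set.finite_range
    (fun q => trans K q' (ν q') Finset.univ ((f q).getD []))).subset
  rintro c ⟨q, l, _, h, rfl⟩
  exact ⟨q, by simp [h]⟩

def key (c : Code) : List (ℕ ×ₗ ℕ) := c.map toLex

lemma key_le {p : Code} {x y : ℕ × ℕ} {l l' : Code}
    (h : key (p ++ x :: l) ≤ key (p ++ y :: l')) : toLex x ≤ toLex y := by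
  induction p with
  | nil =>
    by_contra hc
    push Not at hc
    have : key ([] ++ y :: l') < key ([] ++ x :: l) := by
      simp only [key, List.nil_append, List.map_cons]
      exact List.Lex.rel hc
    exact absurd h (not_le.2 this)
  | cons a p ih =>
    apply ih
    by_contra hc
    push Not at hc
    have : key (a :: p ++ y :: l') < key (a :: p ++ x :: l) := by
      simp only [key, List.cons_append, List.map_cons] at hc ⊢
      exact List.Lex.cons hc
    exact absurd h (not_le.2 this)

open Classical in
noncomputable def F1 : Conf Q := fun q' =>
  if h : (cand K ν R f q').Nonempty then
    some (Classical.choose (Set.exists_min_image _ key (cand_fin K ν R f q') h)) else none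

lemma F1_spec {q' : Q} {c : Code} (h : F1 K ν R f q' = some c) :
    c ∈ cand K ν R f q' ∧ ∀ c' ∈ cand K ν R f q', key c ≤ key c' := by
  unfold F1 at h
  split_ifs at h with hn
  have := Classical.choose_spec (Set.exists_min_image _ key (cand_fin K ν R f q') hn)
  rw [Option.some.inj h] at this
  exact this

lemma F1_some {q q' : Q} {l : Code} (h : R q q') (hl : f q = some l) :
    ∃ c, F1 K ν R f q' = some c := by
  unfold F1
  rw [dif_pos ⟨_, q, l, h, hl, rfl⟩]
  exact ⟨_, rfl⟩

variable {K ν R f}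

lemma F1_old {N : ℕ} (hν : ∀ q, N ≤ ν q) {q' : Q} {c p : Code} (h : F1 K ν R f q' = some c)
    (hp : p <+: c) (hN : ∀ e ∈ p, e.2 < N) :
    ∃ q l, R q q' ∧ f q = some l ∧ c = trans K q' (ν q') Finset.univ l ∧ p <+: l ∧
      q' ∈ sat K Finset.univ p := by
  obtain ⟨⟨q, l, h1, h2, rfl⟩, -⟩ := F1_spec K ν R f h
  exact ⟨q, l, h1, h2, rfl, trans_old K q' (ν q') N (hν q') _ l p (Finset.mem_univ _) hp hN⟩

lemma F1_nd {N : ℕ} (hν : ∀ q, N ≤ ν q) {p : Code} (h : nd (F1 K ν R f) p)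
    (hN : ∀ e ∈ p, e.2 < N) : nd f p := by
  obtain ⟨q, l, h1, h2⟩ := h
  obtain ⟨q0, l0, _, h3, _, h4, _⟩ := F1_old hν h1 h2 hN
  exact ⟨q0, l0, h3, h4⟩

lemma F1_stamp {N : ℕ} (hf : Inv K N f) {q' : Q} {c u : Code} {e : ℕ × ℕ}
    (h : F1 K ν R f q' = some c) (hp : u ++ [e] <+: c) :
    (∀ x ∈ u ++ [e], x.2 < N) ∨ ((∀ x ∈ u, x.2 < N) ∧ e.2 = ν q') ∨
    ((∃ x ∈ u, x.2 = ν q') ∧ e.2 = 0 ∧ e.1 ≠ 0) := by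
  obtain ⟨⟨q, l, h1, h2, rfl⟩, -⟩ := F1_spec K ν R f h
  exact trans_new K q' (ν q') N _ l u e (Finset.mem_univ _) (hf.lt' h2) hp

lemma snoc_prefix_eq {u c : Code} {e e' : ℕ × ℕ} (h : u ++ [e] <+: c) (h' : u ++ [e'] <+: c) :
    e = e' := by
  have h1 := List.prefix_of_prefix_length_le h h' (by simp)
  have h2 := h1.eq_of_length (by simp)
  simpa using h2

lemma F1_mem_nu {N : ℕ} (hf : Inv K N f) (hν : ∀ q, N ≤ ν q) (hN : 0 < N)
    (hinj : Function.Injective ν) {q q' : Q} {c u : Code}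
    (h : F1 K ν R f q = some c) (hp : u <+: c) (hx : ∃ x ∈ u, x.2 = ν q') : q = q' := by
  obtain ⟨x, hx, hx2⟩ := hx
  obtain ⟨w, hw⟩ := mem_split_prefix hx
  have h1 := hν q'
  rcases F1_stamp hf h (hw.trans hp) with h2 | ⟨_, h2⟩ | ⟨_, h2, _⟩
  · have := h2 x (by simp); omega
  · exact hinj (h2.symm.trans hx2)
  · omega

lemma F1_inv {N : ℕ} (hf : Inv K N f) (hν : ∀ q, N ≤ ν q) (hN : 0 < N)
    (hinj : Function.Injective ν) : PreInv K (F1 K ν R f) where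
  val := by
    intro q' l h
    obtain ⟨⟨q, l, h1, h2, rfl⟩, -⟩ := F1_spec K ν R f h
    exact valid_trans _ _ _ _ _ (hf.val q l h2)
  uniq := by
    rintro u e u' e' ⟨q, c, h1, h2⟩ ⟨q', c', h1', h2'⟩ he h0
    have hq := hν q
    have hq' := hν q'
    rcases F1_stamp hf h1 h2 with h3 | ⟨h3, h4⟩ | ⟨_, h4, _⟩
    · rcases F1_stamp hf h1' h2' with h3' | ⟨h3', h4'⟩ | ⟨_, h4', _⟩
      · exact hf.uniq u e u' e' (F1_nd hν ⟨q, c, h1, h2⟩ h3) (F1_nd hν ⟨q', c', h1', h2'⟩ h3') he h0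
      · have := h3 e (by simp); omega
      · omega
    · rcases F1_stamp hf h1' h2' with h3' | ⟨h3', h4'⟩ | ⟨_, h4', _⟩
      · have := h3' e' (by simp); omega
      · obtain rfl : q = q' := hinj (by omega)
        obtain rfl : c = c' := by rw [h1] at h1'; exact Option.some.inj h1'
        have key : ∀ (u u' : Code) (e e' : ℕ × ℕ), u ++ [e] <+: c → u' ++ [e'] <+: c →
            (∀ x ∈ u', x.2 < N) → e.2 = ν q → u'.length ≤ u.length := by
          intro u u' e e' h h' h5 h6
          by_contra hlt
          push Not at hlt
          have h7 := List.prefix_of_prefix_length_le h ((List.prefix_append u' [e']).trans h')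
            (by simp; omega)
          have := h5 e (h7.subset (by simp))
          omega
        have hlen : u.length = u'.length :=
          le_antisymm (key u' u e' e h2' h2 h3 h4') (key u u' e e' h2 h2' h3' h4)
        have h8 := (List.prefix_of_prefix_length_le h2 h2' (by simp [hlen])).eq_of_length
          (by simp [hlen])
        have := List.append_inj' h8 rfl
        exact ⟨this.1, by simpa using this.2⟩
      · omega
    · omega
  z1 := by
    rintro u e ⟨q, c, h1, h2⟩ h0
    have hq := hν q
    rcases F1_stamp hf h1 h2 with h3 | ⟨h3, h4⟩ | ⟨_, _, h4⟩
    · exact hf.z1 u e (F1_nd hν ⟨q, c, h1, h2⟩ h3) h0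
    · omega
    · exact h4
  z2 := by
    rintro u e e' ⟨q, c, h1, h2⟩ ⟨q', c', h1', h2'⟩ h0 h0'
    have hq := hν q
    have hq' := hν q'
    have fin : q = q' → e = e' := by
      rintro rfl
      obtain rfl : c = c' := by rw [h1] at h1'; exact Option.some.inj h1'
      exact snoc_prefix_eq h2 h2'
    rcases F1_stamp hf h1 h2 with h3 | ⟨h3, h4⟩ | ⟨h4, _, _⟩
    · rcases F1_stamp hf h1' h2' with h3' | ⟨h3', h4'⟩ | ⟨h4', _, _⟩
      · exact hf.z2 u e e' (F1_nd hν ⟨q, c, h1, h2⟩ h3) (F1_nd hν ⟨q', c', h1', h2'⟩ h3') h0 h0'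
      · omega
      · apply fin
        exact F1_mem_nu hf hν hN hinj h1 ((List.prefix_append _ _).trans h2) h4'
    · omega
    · apply fin
      exact (F1_mem_nu hf hν hN hinj h1' ((List.prefix_append _ _).trans h2') h4).symm
end F1

/-! ### flashing -/
section F2
variable [Fintype Q] (K : Skel Q) (g : Conf Q)

def flash (p : Code) : Prop := ∀ q l e, g q = some l → p ++ [e] <+: l → e.1 = 0

noncomputable def fll (c : Code) : ℕ := sInf {k | flash g (c.take k)}

noncomputable def F2 : Conf Q := fun q =>
  (g q).map fun c => c.take (fll g c) ++ zext K (sat K Finset.univ (c.take (fll g c)))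

variable {K g}

lemma valid_snoc {S : Finset Q} {c l : Code} {e : ℕ × ℕ} (hc : valid K S c) (hl : valid K S l)
    (h : c ++ [e] <+: l) : False := by
  obtain ⟨t, rfl⟩ := h
  have h1 := valid_append K S c ([e] ++ t) (by simpa using hl)
  have h2 := valid_append K S c [] (by simpa using hc)
  exact h1.1 h2

lemma flash_full (hg : PreInv K g) {q : Q} {c : Code} (h : g q = some c) : flash g c := by
  intro q' l e hl hp
  exact (valid_snoc (hg.val _ _ h) (hg.val _ _ hl) hp).elim

lemma fll_le (hg : PreInv K g) {q : Q} {c : Code} (h : g q = some c) : fll g c ≤ c.length := by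
  apply Nat.sInf_le
  simpa using flash_full hg h

lemma fll_flash (hg : PreInv K g) {q : Q} {c : Code} (h : g q = some c) :
    flash g (c.take (fll g c)) := by
  have : fll g c ∈ {k | flash g (c.take k)} :=
    Nat.sInf_mem ⟨c.length, by simpa using flash_full hg h⟩
  exact this

lemma fll_min {c p : Code} (hp : p <+: c) (hf : flash g p) :
    fll g c ≤ p.length := by
  apply Nat.sInf_le
  rw [List.prefix_iff_eq_take] at hp
  simpa [← hp] using hf

lemma F2_some {q : Q} {d : Code} (h : F2 K g q = some d) : ∃ c, g q = some c ∧
    d = c.take (fll g c) ++ zext K (sat K Finset.univ (c.take (fll g c))) := by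
  unfold F2 at h
  rw [Option.map_eq_some_iff] at h
  obtain ⟨c, h1, h2⟩ := h
  exact ⟨c, h1, h2.symm⟩

/-- agreement up to the flash prefix -/
lemma F2_low (hg : PreInv K g) {q : Q} {c d u : Code} (h : g q = some c)
    (hd : d = c.take (fll g c) ++ zext K (sat K Finset.univ (c.take (fll g c))))
    (hu : u.length ≤ fll g c) : u <+: d ↔ u <+: c := by
  have h1 := fll_le hg h
  have h2 : (c.take (fll g c)).length = fll g c := by simp [h1]
  constructor
  · intro h3
    have := List.prefix_of_prefix_length_le h3 (hd ▸ List.prefix_append _ _) (by rw [h2]; exact hu)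
    exact this.trans (List.take_prefix _ _)
  · intro h3
    have := List.prefix_of_prefix_length_le h3 (List.take_prefix (fll g c) c) (by rw [h2]; exact hu)
    rw [hd]
    exact this.trans (List.prefix_append _ _)

lemma FL (hg : PreInv K g) {q q' : Q} {c c' d d' u : Code} (h : g q = some c) (h' : g q' = some c')
    (hd : d = c.take (fll g c) ++ zext K (sat K Finset.univ (c.take (fll g c))))
    (hd' : d' = c'.take (fll g c') ++ zext K (sat K Finset.univ (c'.take (fll g c'))))
    (hu : fll g c ≤ u.length) (h1 : u <+: d) (h2 : u <+: d') :
    c.take (fll g c) = c'.take (fll g c') := by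
  have a1 := fll_le hg h
  have a2 := fll_le hg h'
  have b1 : (c.take (fll g c)).length = fll g c := by simp [a1]
  have b2 : (c'.take (fll g c')).length = fll g c' := by simp [a2]
  have e1 : c.take (fll g c) <+: u :=
    List.prefix_of_prefix_length_le (hd ▸ List.prefix_append _ _) h1 (by omega)
  have e2 : c.take (fll g c) <+: d' := e1.trans h2
  have e3 : c'.take (fll g c') <+: d' := hd' ▸ List.prefix_append _ _
  rcases lt_trichotomy (fll g c) (fll g c') with hlt | heq | hlt
  · exfalso
    have := List.prefix_of_prefix_length_le e2 e3 (by omega)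
    have := fll_min (this.trans (List.take_prefix _ _)) (fll_flash hg h)
    omega
  · exact (List.prefix_of_prefix_length_le e2 e3 (by omega)).eq_of_length (by omega)
  · exfalso
    have := List.prefix_of_prefix_length_le e3 e2 (by omega)
    have := fll_min (this.trans (List.take_prefix _ _)) (fll_flash hg h')
    omega

lemma F2_high (hg : PreInv K g) {q : Q} {c d u : Code} {e : ℕ × ℕ} (h : g q = some c)
    (hd : d = c.take (fll g c) ++ zext K (sat K Finset.univ (c.take (fll g c))))
    (hu : fll g c ≤ u.length) (hp : u ++ [e] <+: d) : e.2 = 0 ∧ e.1 ≠ 0 := by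
  have a1 := fll_le hg h
  have b1 : (c.take (fll g c)).length = fll g c := by simp [a1]
  have e1 : c.take (fll g c) <+: u :=
    List.prefix_of_prefix_length_le (hd ▸ List.prefix_append _ _)
      ((List.prefix_append _ _).trans hp) (by omega)
  obtain ⟨t, rfl⟩ := e1
  rw [hd, List.append_assoc, List.prefix_append_right_inj] at hp
  exact (zext_spec K _).2 e (hp.subset (by simp))

lemma F2_inv (hg : PreInv K g) : PreInv K (F2 K g) where
  val := by
    intro q d h
    obtain ⟨c, h1, rfl⟩ := F2_some h
    refine valid_replace K _ _ (c.drop (fll g c)) _ ?_ (zext_spec K _).1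
    rw [List.take_append_drop]; exact hg.val q c h1
  uniq := by
    rintro u e u' e' ⟨q, d, h1, h2⟩ ⟨q', d', h1', h2'⟩ he h0
    obtain ⟨c, h3, h4⟩ := F2_some h1
    obtain ⟨c', h3', h4'⟩ := F2_some h1'
    have a : u.length < fll g c := by
      by_contra hc
      exact h0 (F2_high hg h3 h4 (by omega) h2).1
    have a' : u'.length < fll g c' := by
      by_contra hc
      exact h0 (he.trans (F2_high hg h3' h4' (by omega) h2').1)
    exact hg.uniq u e u' e' ⟨q, c, h3, (F2_low hg h3 h4 (by simp; omega)).1 h2⟩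
      ⟨q', c', h3', (F2_low hg h3' h4' (by simp; omega)).1 h2'⟩ he h0
  z1 := by
    rintro u e ⟨q, d, h1, h2⟩ h0
    obtain ⟨c, h3, h4⟩ := F2_some h1
    by_cases a : u.length < fll g c
    · exact hg.z1 u e ⟨q, c, h3, (F2_low hg h3 h4 (by simp; omega)).1 h2⟩ h0
    · exact (F2_high hg h3 h4 (by omega) h2).2
  z2 := by
    rintro u e e' ⟨q, d, h1, h2⟩ ⟨q', d', h1', h2'⟩ h0 h0'
    obtain ⟨c, h3, h4⟩ := F2_some h1
    obtain ⟨c', h3', h4'⟩ := F2_some h1'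
    have fin : c.take (fll g c) = c'.take (fll g c') → e = e' := by
      intro h5
      have : d = d' := by rw [h4, h4', h5]
      subst this
      exact snoc_prefix_eq h2 h2'
    by_cases a : u.length < fll g c
    · by_cases a' : u.length < fll g c'
      · exact hg.z2 u e e' ⟨q, c, h3, (F2_low hg h3 h4 (by simp; omega)).1 h2⟩
          ⟨q', c', h3', (F2_low hg h3' h4' (by simp; omega)).1 h2'⟩ h0 h0'
      · exact fin (FL hg h3' h3 h4' h4 (not_lt.1 a') ((List.prefix_append _ _).trans h2')
          ((List.prefix_append _ _).trans h2)).symm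
    · exact fin (FL hg h3 h3' h4 h4' (not_lt.1 a) ((List.prefix_append _ _).trans h2)
        ((List.prefix_append _ _).trans h2'))

lemma F2_nz (hg : PreInv K g) {u : Code} {e : ℕ × ℕ} (h : nd (F2 K g) (u ++ [e])) :
    ∃ e', nd (F2 K g) (u ++ [e']) ∧ e'.1 ≠ 0 := by
  obtain ⟨q, d, h1, h2⟩ := h
  obtain ⟨c, h3, h4⟩ := F2_some h1
  by_cases a : u.length < fll g c
  · have h5 : u <+: c := (F2_low hg h3 h4 a.le).1 ((List.prefix_append _ _).trans h2)
    have hnf : ¬ flash g u := fun hf => by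
      have := fll_min h5 hf
      omega
    unfold flash at hnf
    push Not at hnf
    obtain ⟨q', c', e', h6, h7, h8⟩ := hnf
    refine ⟨e', ⟨q', _, by rw [F2, h6]; rfl, ?_⟩, h8⟩
    have : u.length < fll g c' := by
      by_contra hc
      have a2 := fll_le hg h6
      have b2 : (c'.take (fll g c')).length = fll g c' := by simp [a2]
      have h9 : c'.take (fll g c') <+: u := List.prefix_of_prefix_length_le
        (List.take_prefix _ _) ((List.prefix_append _ _).trans h7) (by omega)
      have := fll_min (h9.trans h5) (fll_flash hg h6)
      omega
    exact (F2_low hg h6 rfl (by simp; omega)).2 h7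
  · exact ⟨e, ⟨q, d, h1, h2⟩, (F2_high hg h3 h4 (not_lt.1 a) h2).2⟩
end F2
end SD

namespace SD
variable {Q : Type}

lemma valid_congr (K : Skel Q) (S : Finset Q) (l l' : Code) (h : l.map Prod.fst = l'.map Prod.fst) :
    valid K S l ↔ valid K S l' := by
  induction l generalizing S l' with
  | nil => cases l' with
    | nil => rfl
    | cons a l' => simp at h
  | cons e l ih => cases l' with
    | nil => simp at h
    | cons a l' =>
      simp only [List.map_cons, List.cons.injEq] at h
      rw [valid, valid, h.1, ih _ _ h.2]

lemma sat_congr (K : Skel Q) (S : Finset Q) (l l' : Code) (h : l.map Prod.fst = l'.map Prod.fst) :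
    sat K S l = sat K S l' := by
  induction l generalizing S l' with
  | nil => cases l' with
    | nil => rfl
    | cons a l' => simp at h
  | cons e l ih => cases l' with
    | nil => simp at h
    | cons a l' =>
      simp only [List.map_cons, List.cons.injEq] at h
      rw [sat, sat, h.1, ih _ _ h.2]

def norm (lab : Code → ℕ × ℕ → ℕ) : Code → Code → Code
  | _, [] => []
  | u, e :: l => (e.1, lab u e) :: norm lab (u ++ [e]) l

def lastnd (lab : Code → ℕ × ℕ → ℕ) : Code → Code → ℕ → ℕ
  | _, [], c => c
  | u, e :: l, c => lastnd lab (u ++ [e]) l (if lab u e = 0 then c else e.2)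

lemma norm_append (lab : Code → ℕ × ℕ → ℕ) (u v w : Code) :
    norm lab u (v ++ w) = norm lab u v ++ norm lab (u ++ v) w := by
  induction v generalizing u with
  | nil => simp [norm]
  | cons e v ih => simp [norm, ih]

lemma lastnd_append (lab : Code → ℕ × ℕ → ℕ) (u v w : Code) (c : ℕ) :
    lastnd lab u (v ++ w) c = lastnd lab (u ++ v) w (lastnd lab u v c) := by
  induction v generalizing u c with
  | nil => simp [lastnd]
  | cons e v ih => simp [lastnd, ih]

lemma lastnd_zero (lab : Code → ℕ × ℕ → ℕ) (u z : Code) (c : ℕ)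
    (h : ∀ e ∈ norm lab u z, e.2 = 0) : lastnd lab u z c = c := by
  induction z generalizing u c with
  | nil => rfl
  | cons e z ih =>
    simp only [norm, List.mem_cons, forall_eq_or_imp] at h
    rw [lastnd, if_pos h.1, ih _ _ h.2]

lemma norm_fst (lab : Code → ℕ × ℕ → ℕ) (u v : Code) :
    (norm lab u v).map Prod.fst = v.map Prod.fst := by
  induction v generalizing u with
  | nil => rfl
  | cons e v ih => simp [norm, ih]

lemma norm_length (lab : Code → ℕ × ℕ → ℕ) (u v : Code) :
    (norm lab u v).length = v.length := by
  simpa using congrArg List.length (norm_fst lab u v)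

lemma norm_take (lab : Code → ℕ × ℕ → ℕ) (u v : Code) (k : ℕ) :
    (norm lab u v).take k = norm lab u (v.take k) := by
  induction v generalizing u k with
  | nil => simp [norm]
  | cons e v ih => cases k with
    | zero => simp [norm]
    | succ k => simp [norm, ih]

lemma norm_prefix (lab : Code → ℕ × ℕ → ℕ) {p d : Code} (h : p <+: norm lab [] d) :
    ∃ u, u <+: d ∧ p = norm lab [] u := by
  refine ⟨d.take p.length, List.take_prefix _ _, ?_⟩
  rw [← norm_take]
  exact List.prefix_iff_eq_take.1 h

lemma prefix_norm (lab : Code → ℕ × ℕ → ℕ) {u d : Code} (h : u <+: d) :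
    norm lab [] u <+: norm lab [] d := by
  obtain ⟨t, rfl⟩ := h
  rw [norm_append]; exact List.prefix_append _ _

section F3
variable (g : Conf Q)

def des (u : Code) (e : ℕ × ℕ) : Prop :=
  e.1 ≠ 0 ∧ ∀ e', nd g (u ++ [e']) → e'.1 ≠ 0 → e.2 ≤ e'.2

def PP (s : ℕ) : Prop := s = 0 ∨ ∃ u e, nd g (u ++ [e]) ∧ ¬ des g u e ∧ e.2 = s

open Classical in
noncomputable def lab (u : Code) (e : ℕ × ℕ) : ℕ :=
  if des g u e then 0 else Nat.count (PP g) e.2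

noncomputable def F3 : Conf Q := fun q => (g q).map (norm (lab g) [])

variable {g}

lemma lab_le (u : Code) (e : ℕ × ℕ) : lab g u e ≤ e.2 := by
  classical
  unfold lab
  split_ifs
  · exact Nat.zero_le _
  · exact Nat.count_le _

lemma F3_some {q : Q} {l : Code} (h : F3 g q = some l) :
    ∃ d, g q = some d ∧ l = norm (lab g) [] d := by
  unfold F3 at h
  rw [Option.map_eq_some_iff] at h
  obtain ⟨c, h1, h2⟩ := h
  exact ⟨c, h1, h2.symm⟩

lemma F3_nd {p : Code} (h : nd (F3 g) p) : ∃ u, nd g u ∧ p = norm (lab g) [] u := by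
  obtain ⟨q, l, h1, h2⟩ := h
  obtain ⟨d, h3, rfl⟩ := F3_some h1
  obtain ⟨u, h4, h5⟩ := norm_prefix _ h2
  exact ⟨u, ⟨q, d, h3, h4⟩, h5⟩

lemma F3_nd_snoc {p : Code} {e' : ℕ × ℕ} (h : nd (F3 g) (p ++ [e'])) :
    ∃ u e, nd g (u ++ [e]) ∧ p = norm (lab g) [] u ∧ e' = (e.1, lab g u e) := by
  obtain ⟨u, h1, h2⟩ := F3_nd h
  rcases List.eq_nil_or_concat u with rfl | ⟨u, e, rfl⟩
  · simp [norm] at h2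
  · rw [List.concat_eq_append] at *
    rw [norm_append] at h2
    have := List.append_inj' h2 rfl
    refine ⟨u, e, h1, this.1, by simpa [norm] using this.2⟩

variable [Fintype Q] {K : Skel Q}

lemma lab_eq_zero (hg : PreInv K g) {u : Code} {e : ℕ × ℕ} (h : nd g (u ++ [e]))
    (h0 : lab g u e = 0) : des g u e := by
  classical
  by_contra hd
  unfold lab at h0
  rw [if_neg hd] at h0
  by_cases he : e.2 = 0
  · exact hd ⟨hg.z1 u e h he, fun e' _ _ => by omega⟩
  · have := Nat.count_strict_mono (p := PP g) (m := 0) (n := e.2) (Or.inl rfl) (by omega)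
    omega

lemma lab_stamp (hg : PreInv K g) {u u' : Code} {e e' : ℕ × ℕ} (h : nd g (u ++ [e]))
    (h' : nd g (u' ++ [e'])) (h0 : lab g u e ≠ 0) (hh : lab g u e = lab g u' e') :
    e.2 = e'.2 ∧ e.2 ≠ 0 := by
  classical
  have hd : ¬ des g u e := fun hd => h0 (by rw [lab, if_pos hd])
  have hd' : ¬ des g u' e' := fun hd => h0 (by rw [hh, lab, if_pos hd])
  refine ⟨?_, fun h1 => h0 ?_⟩
  · unfold lab at hh
    rw [if_neg hd, if_neg hd'] at hh
    exact Nat.count_injective (p := PP g) (Or.inr ⟨u, e, h, hd, rfl⟩)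
      (Or.inr ⟨u', e', h', hd', rfl⟩) hh
  · have := lab_le (g := g) u e
    omega

lemma sib_eq (hg : PreInv K g) {u : Code} {e e' : ℕ × ℕ} (h : nd g (u ++ [e]))
    (h' : nd g (u ++ [e'])) (hh : lab g u e = lab g u e') : e = e' := by
  have key : e.2 = e'.2 → e = e' := by
    intro h1
    by_cases h0 : e.2 = 0
    · exact hg.z2 u e e' h h' h0 (by omega)
    · exact (hg.uniq u e u e' h h' h1 h0).2
  apply key
  by_cases h0 : lab g u e = 0
  · have d := lab_eq_zero hg h h0
    have d' := lab_eq_zero hg h' (by omega)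
    exact le_antisymm (d.2 _ h' d'.1) (d'.2 _ h d.1)
  · exact (lab_stamp hg h h' h0 hh).1

lemma norm_inj (hg : PreInv K g) {u u' : Code} (h : nd g u) (h' : nd g u')
    (hh : norm (lab g) [] u = norm (lab g) [] u') : u = u' := by
  induction u using List.reverseRecOn generalizing u' with
  | nil =>
    have := congrArg List.length hh
    rw [norm_length, norm_length] at this
    exact (List.length_eq_zero_iff.1 this.symm).symm
  | append_singleton u e ih =>
    rcases List.eq_nil_or_concat u' with rfl | ⟨u', e', rfl⟩
    · have := congrArg List.length hh
      rw [norm_length, norm_length] at this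
      simp at this
    · rw [List.concat_eq_append] at *
      rw [norm_append, norm_append] at hh
      have h1 := List.append_inj' hh rfl
      have h2 := ih (h.mono (List.prefix_append _ _)) (h'.mono (List.prefix_append _ _)) h1.1
      subst h2
      have h3 : (e.1, lab g u e) = (e'.1, lab g u e') := by simpa [norm] using h1.2
      rw [sib_eq hg h h' (Prod.ext_iff.1 h3).2]

lemma ext_aux (nz : ∀ u e, nd g (u ++ [e]) → ∃ e', nd g (u ++ [e']) ∧ e'.1 ≠ 0)
    (L : ℕ) (hL : ∀ q l, g q = some l → l.length ≤ L) (k : ℕ) (u : Code) (hu : nd g u)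
    (hk : L ≤ u.length + k) :
    ∃ q z, g q = some (u ++ z) ∧ ∀ e ∈ norm (lab g) u z, e.2 = 0 := by
  classical
  induction k generalizing u with
  | zero =>
    obtain ⟨q, l, h1, h2⟩ := hu
    have := hL q l h1
    have := h2.eq_of_length (le_antisymm h2.length_le (by omega))
    exact ⟨q, [], by simp [this, h1], by simp [norm]⟩
  | succ k ih =>
    have hu' := hu
    obtain ⟨q, l, h1, t, rfl⟩ := hu
    cases t with
    | nil => exact ⟨q, [], h1, by simp [norm]⟩
    | cons e t =>
      have hne : ∃ s e', nd g (u ++ [e']) ∧ e'.1 ≠ 0 ∧ e'.2 = s := by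
        obtain ⟨e', h3, h4⟩ := nz u e ⟨q, _, h1, by simp⟩
        exact ⟨_, e', h3, h4, rfl⟩
      obtain ⟨e', h3, h4, h5⟩ := Nat.find_spec hne
      have hd : des g u e' := ⟨h4, fun e'' h6 h7 => by
        rw [h5]; exact Nat.find_min' hne ⟨e'', h6, h7, rfl⟩⟩
      obtain ⟨q', z, h6, h7⟩ := ih (u ++ [e']) h3 (by simp; omega)
      refine ⟨q', e' :: z, by simpa using h6, ?_⟩
      intro x hx
      rw [norm, List.mem_cons] at hx
      rcases hx with rfl | hx
      · simp [lab, hd]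
      · exact h7 x hx

lemma len_bound (g : Conf Q) : ∃ L, ∀ q l, g q = some l → l.length ≤ L := by
  refine ⟨∑ q, ((g q).getD []).length, fun q l h => ?_⟩
  have := Finset.single_le_sum (f := fun q => ((g q).getD []).length) (fun _ _ => Nat.zero_le _)
    (Finset.mem_univ q)
  simpa [h] using this

lemma F3_inv (hg : PreInv K g)
    (nz : ∀ u e, nd g (u ++ [e]) → ∃ e', nd g (u ++ [e']) ∧ e'.1 ≠ 0) :
    Inv K (Fintype.card Q) (F3 g) := by
  classical
  obtain ⟨L, hL⟩ := len_bound g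
  have ext := fun u hu => ext_aux nz L hL L u hu (by omega)
  refine ⟨⟨?_, ?_, ?_, ?_⟩, ?_, ?_⟩
  · intro q l h
    obtain ⟨d, h1, rfl⟩ := F3_some h
    rw [valid_congr K _ _ d (norm_fst _ _ _)]
    exact hg.val q d h1
  · intro p x p' x' h h' hx h0
    obtain ⟨u, e, h1, rfl, rfl⟩ := F3_nd_snoc h
    obtain ⟨u', e', h1', rfl, rfl⟩ := F3_nd_snoc h'
    obtain ⟨h2, h3⟩ := lab_stamp hg h1 h1' h0 hx
    obtain ⟨rfl, rfl⟩ := hg.uniq u e u' e' h1 h1' h2 h3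
    exact ⟨rfl, rfl⟩
  · intro p x h h0
    obtain ⟨u, e, h1, rfl, rfl⟩ := F3_nd_snoc h
    exact (lab_eq_zero hg h1 h0).1
  · intro p x x' h h' h0 h0'
    obtain ⟨u, e, h1, rfl, rfl⟩ := F3_nd_snoc h
    obtain ⟨u', e', h1', hu, rfl⟩ := F3_nd_snoc h'
    have := norm_inj hg (h1.mono (List.prefix_append _ _)) (h1'.mono (List.prefix_append _ _)) hu
    subst this
    have := sib_eq hg h1 h1' (h0.trans h0'.symm)
    rw [this]
  · intro p hp
    obtain ⟨u, h1, rfl⟩ := F3_nd hp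
    obtain ⟨q, z, h2, h3⟩ := ext u h1
    exact ⟨q, norm (lab g) u z, by rw [F3, h2, Option.map_some, norm_append]; rfl, h3⟩
  · intro p x h
    obtain ⟨u, e, h1, rfl, rfl⟩ := F3_nd_snoc h
    have hP : ∀ s, PP g s → ∃ q, lastnd (lab g) [] ((g q).getD []) 0 = s := by
      rintro s (rfl | ⟨v, e', h2, h3, rfl⟩)
      · obtain ⟨q, z, h4, h5⟩ := ext [] (h1.mono (by simp))
        exact ⟨q, by rw [h4]; exact lastnd_zero _ _ _ _ h5⟩
      · obtain ⟨q, z, h4, h5⟩ := ext _ h2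
        refine ⟨q, ?_⟩
        rw [h4, Option.getD_some, lastnd_append, List.nil_append, lastnd_zero _ _ _ _ h5,
          lastnd_append]
        have : lab g v e' ≠ 0 := fun h0 => h3 (lab_eq_zero hg h2 h0)
        simp [lastnd, this]
    unfold lab
    split_ifs with hd
    · obtain ⟨q, -⟩ := h1
      exact Fintype.card_pos_iff.2 ⟨q⟩
    · have hp : PP g e.2 := Or.inr ⟨u, e, h1, hd, rfl⟩
      have h2 : Nat.count (PP g) (e.2 + 1) = Nat.count (PP g) e.2 + 1 := by
        rw [Nat.count_succ, if_pos hp]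
      have h3 : (Finset.filter (PP g) (Finset.range (e.2 + 1))) ⊆
          Finset.univ.image (fun q => lastnd (lab g) [] ((g q).getD []) 0) := by
        intro s hs
        obtain ⟨q, hq⟩ := hP s (Finset.mem_filter.1 hs).2
        exact Finset.mem_image.2 ⟨q, Finset.mem_univ _, hq⟩
      have h4 := (Finset.card_le_card h3).trans Finset.card_image_le
      rw [← Nat.count_eq_card_filter_range, h2] at h4
      simpa using h4
end F3

end SD

namespace SD
variable {Q : Type}

/-! ### names -/
def lst (p : Code) : ℕ := ((p.map Prod.snd).filter (· ≠ 0)).getLastD 0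
def lev (p : Code) : ℕ := (p.filter (fun e => e.1 ≠ 0)).length

lemma lst_nil : lst [] = 0 := rfl
lemma lev_nil : lev [] = 0 := rfl
lemma lst_snoc (u : Code) (e : ℕ × ℕ) : lst (u ++ [e]) = if e.2 = 0 then lst u else e.2 := by
  unfold lst
  split_ifs with h
  · simp [List.filter_append, h]
  · simp [List.filter_append, h]
lemma lev_snoc (u : Code) (e : ℕ × ℕ) : lev (u ++ [e]) = lev u + if e.1 = 0 then 0 else 1 := by
  unfold lev
  split_ifs with h <;> simp [List.filter_append, h]
lemma lev_mono {p u : Code} (h : p <+: u) : lev p ≤ lev u := by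
  obtain ⟨t, rfl⟩ := h
  simp [lev, List.filter_append]

lemma lst_head (u : Code) (h : lst u ≠ 0) : ∃ w e, w ++ [e] <+: u ∧ e.2 = lst u := by
  induction u using List.reverseRecOn with
  | nil => exact (h rfl).elim
  | append_singleton u e ih =>
    rw [lst_snoc] at h ⊢
    split_ifs at h ⊢ with h0
    · obtain ⟨w, e', h1, h2⟩ := ih h
      exact ⟨w, e', h1.trans (List.prefix_append _ _), h2⟩
    · exact ⟨u, e, List.prefix_refl _, rfl⟩

variable [Fintype Q] {K : Skel Q} {N : ℕ} {f : Conf Q}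

lemma name_aux (hf : PreInv K f) {u u' : Code} {e e' : ℕ × ℕ} (h : nd f (u ++ [e]))
    (h' : nd f (u' ++ [e'])) (h0 : e.2 = 0) (h0' : e'.2 ≠ 0)
    (h1 : lst (u ++ [e]) = lst (u' ++ [e'])) : lev (u ++ [e]) ≠ lev (u' ++ [e']) := by
  rw [lst_snoc, lst_snoc, if_pos h0, if_neg h0'] at h1
  obtain ⟨w, x, h2, h3⟩ := lst_head u (by omega)
  obtain ⟨rfl, rfl⟩ := hf.uniq w x u' e' (h.mono (h2.trans (List.prefix_append _ _))) h' (by omega) (by omega)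
  have := lev_mono h2
  rw [lev_snoc u e, if_neg (hf.z1 u e h h0)]
  omega

lemma name_nil (hf : PreInv K f) {u : Code} {e : ℕ × ℕ} (h : nd f (u ++ [e]))
    (h1 : lst (u ++ [e]) = 0) : lev (u ++ [e]) ≠ 0 := by
  rw [lst_snoc] at h1
  have h0 : e.2 = 0 := by
    by_contra h0
    rw [if_neg h0] at h1
    exact h0 h1
  rw [lev_snoc u e, if_neg (hf.z1 u e h h0)]
  omega

lemma name_inj (hf : PreInv K f) {p p' : Code} (h : nd f p) (h' : nd f p')
    (h1 : lst p = lst p') (h2 : lev p = lev p') : p = p' := by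
  induction p using List.reverseRecOn generalizing p' with
  | nil =>
    rcases List.eq_nil_or_concat p' with rfl | ⟨u', e', rfl⟩
    · rfl
    · rw [List.concat_eq_append] at *
      exact (name_nil hf h' h1.symm h2.symm).elim
  | append_singleton u e ih =>
    rcases List.eq_nil_or_concat p' with rfl | ⟨u', e', rfl⟩
    · exact (name_nil hf h h1 h2).elim
    · rw [List.concat_eq_append] at *
      by_cases h0 : e.2 = 0
      · by_cases h0' : e'.2 = 0
        · rw [lst_snoc, lst_snoc, if_pos h0, if_pos h0'] at h1
          rw [lev_snoc, lev_snoc, if_neg (hf.z1 u e h h0), if_neg (hf.z1 u' e' h' h0')] at h2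
          obtain rfl := ih (h.mono (List.prefix_append _ _)) (h'.mono (List.prefix_append _ _)) h1 (by omega)
          rw [hf.z2 u e e' h h' h0 h0']
        · exact (name_aux hf h h' h0 h0' h1 h2).elim
      · by_cases h0' : e'.2 = 0
        · exact (name_aux hf h' h h0' h0 h1.symm h2.symm).elim
        · rw [lst_snoc, lst_snoc, if_neg h0, if_neg h0'] at h1
          obtain ⟨rfl, rfl⟩ := hf.uniq u e u' e' h h' h1 h0
          rfl

lemma lst_lt (hf : Inv K N f) (hN : 0 < N) {p : Code} (h : nd f p) : lst p < N := by
  by_cases h0 : lst p = 0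
  · omega
  · obtain ⟨w, e, h1, h2⟩ := lst_head p h0
    rw [← h2]
    exact hf.lt w e (h.mono h1)

lemma lev_cons (e : ℕ × ℕ) (l : Code) : lev (e :: l) = (if e.1 = 0 then 0 else 1) + lev l := by
  unfold lev
  split_ifs with h <;> simp [List.filter_cons, h]; omega

lemma lev_le_dep (S : Finset Q) (l : Code) (h : valid K S l) : lev l ≤ K.dep S := by
  induction l generalizing S with
  | nil => simp [lev_nil]
  | cons e l ih =>
    have := ih _ h.2.2
    rw [lev_cons]
    split_ifs with h0
    · rw [h0, K.nx_zero] at this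
      omega
    · have := K.dep_lt S e.1 h0 h.2.1
      omega

lemma stamps_nodup (hf : PreInv K f) (l : Code) (h : nd f l) :
    ((l.filter (fun e => e.2 ≠ 0)).map Prod.snd).Nodup := by
  induction l using List.reverseRecOn with
  | nil => simp
  | append_singleton u e ih =>
    have ih := ih (h.mono (List.prefix_append _ _))
    rw [List.filter_append, List.map_append, List.nodup_append]
    refine ⟨ih, ?_, ?_⟩
    · by_cases h0 : e.2 = 0 <;> simp [List.filter_cons, h0]
    · intro a ha b hb hab
      subst hab
      rw [List.mem_map] at ha hb
      obtain ⟨x, hx, rfl⟩ := ha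
      obtain ⟨y, hy, hyx⟩ := hb
      rw [List.mem_filter] at hx hy
      simp at hx hy
      obtain ⟨rfl, hy⟩ := hy
      obtain ⟨w, hw⟩ := mem_split_prefix hx.1
      obtain ⟨h1, h2⟩ := hf.uniq u y w x h (h.mono (hw.trans (List.prefix_append _ _))) hyx hy
      have := hw.length_le
      simp [h1] at this

lemma length_le (hf : Inv K N f) {q : Q} {l : Code} (h : f q = some l) :
    l.length ≤ K.dep Finset.univ + N := by
  have hn : nd f l := ⟨q, l, h, List.prefix_refl _⟩
  have h1 := lev_le_dep _ l (hf.val q l h)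
  have h2 : ((l.filter (fun e => e.2 ≠ 0)).map Prod.snd).length ≤ N := by
    rw [← List.toFinset_card_of_nodup (stamps_nodup hf.toPreInv l hn), ← Finset.card_range N]
    apply Finset.card_le_card
    intro s hs
    simp only [List.mem_toFinset, List.mem_map, List.mem_filter] at hs
    obtain ⟨e, he, rfl⟩ := hs
    simpa using hf.lt' h e he.1
  have h3 : ∀ l : Code, (∀ e ∈ l, e.2 = 0 → e.1 ≠ 0) →
      l.length ≤ lev l + ((l.filter (fun e => e.2 ≠ 0)).map Prod.snd).length := by
    intro l hl
    induction l with
    | nil => simp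
    | cons e l ih =>
      have ih := ih (fun x hx => hl x (by simp [hx]))
      have := hl e (by simp)
      rw [lev_cons, List.filter_cons]
      by_cases h0 : e.2 = 0
      · simp [h0, this h0] at ih ⊢; omega
      · simp [h0] at ih ⊢; omega
  have := h3 l (fun e he => by
    obtain ⟨u, hu⟩ := mem_split_prefix he
    exact hf.z1 u e ⟨q, l, h, hu⟩)
  omega

/-! ### one step -/
variable (K) in
/-- `p` is a stable node in the step from `g`. -/
def stab (g : Conf Q) (p : Code) (q : Q) : Prop :=
  ∃ c d, g q = some c ∧ F3 (F2 K g) q = some d ∧ p <+: c ∧ p.length ≤ fll g c ∧ p <+: d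

variable (K) in
noncomputable def flq (g : Conf Q) (q : Q) : ℕ := (g q).elim 0 (fll g)

variable (K) in
open Classical in
noncomputable def stq (g : Conf Q) (q : Q) : ℕ :=
  Nat.findGreatest (fun k => ((g q).getD []).take k = ((F3 (F2 K g) q).getD []).take k) (flq g q)

lemma next_some {g : Conf Q} {q : Q} {c : Code} (h : g q = some c) :
    F3 (F2 K g) q = some (norm (lab (F2 K g)) []
      (c.take (fll g c) ++ zext K (sat K Finset.univ (c.take (fll g c))))) := by
  simp [F3, F2, h]

lemma next_some' {g : Conf Q} {q : Q} {d : Code} (h : F3 (F2 K g) q = some d) :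
    ∃ c, g q = some c ∧ d = norm (lab (F2 K g)) []
      (c.take (fll g c) ++ zext K (sat K Finset.univ (c.take (fll g c)))) := by
  obtain ⟨e, h1, rfl⟩ := F3_some h
  obtain ⟨c, h2, rfl⟩ := F2_some h1
  exact ⟨c, h2, rfl⟩

lemma stab_iff {g : Conf Q} {q : Q} {d p : Code} (hg : PreInv K g) (h : F3 (F2 K g) q = some d)
    (hp : p <+: d) : stab K g p q ↔ p.length ≤ stq K g q := by
  obtain ⟨c, hc, hd⟩ := next_some' h
  have hfl : flq g q = fll g c := by simp [flq, hc]
  constructor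
  · rintro ⟨c', d', h1, h2, h3, h4, h5⟩
    rw [h] at h2; rw [hc] at h1
    cases h1; cases h2
    apply Nat.le_findGreatest
    · rw [hfl]; exact h4
    · rw [hc, h]
      simp only [Option.getD_some]
      rw [← List.prefix_iff_eq_take.1 h3, ← List.prefix_iff_eq_take.1 h5]
  · intro hle
    have h1 : ((g q).getD []).take (stq K g q) = ((F3 (F2 K g) q).getD []).take (stq K g q) := by
      classical
      unfold stq
      exact Nat.findGreatest_spec (P := fun k => ((g q).getD []).take k = ((F3 (F2 K g) q).getD []).take k)
        (m := 0) (Nat.zero_le _) (by simp)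
    have h2 : stq K g q ≤ flq g q := by
      classical
      exact Nat.findGreatest_le _
    rw [hc, h] at h1
    simp only [Option.getD_some] at h1
    refine ⟨c, d, hc, h, ?_, by omega, hp⟩
    have h3 : p <+: d.take (stq K g q) := by
      rw [List.prefix_take_iff]; exact ⟨hp, hle⟩
    rw [← h1] at h3
    exact h3.trans (List.take_prefix _ _)

lemma stab_norm {g : Conf Q} {q : Q} {p : Code} (hg : PreInv K g) (h : stab K g p q) :
    nd (F2 K g) p ∧ p = norm (lab (F2 K g)) [] p := by
  obtain ⟨c, d, h1, h2, h3, h4, h5⟩ := h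
  obtain ⟨e, h6, rfl⟩ := F3_some h2
  obtain ⟨c', h7, h8⟩ := F2_some h6
  rw [h1] at h7; cases h7
  have h9 := (F2_low hg h1 h8 h4).2 h3
  refine ⟨⟨q, e, h6, h9⟩, ?_⟩
  have := List.prefix_of_prefix_length_le h5 (prefix_norm (lab (F2 K g)) h9) (by rw [norm_length])
  exact this.eq_of_length (by rw [norm_length])

lemma UL {g : Conf Q} {q q' : Q} {p d : Code} (hg : PreInv K g) (h : stab K g p q)
    (h' : F3 (F2 K g) q' = some d) (hp : p <+: d) : stab K g p q' := by
  obtain ⟨hn, hpn⟩ := stab_norm hg h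
  obtain ⟨c, d0, h1, h2, h3, h4, h5⟩ := h
  obtain ⟨e, h6, rfl⟩ := F3_some h'
  obtain ⟨c', h7, h8⟩ := F2_some h6
  refine ⟨c', _, h7, h', ?_⟩
  obtain ⟨u, hu, hpu⟩ := norm_prefix _ hp
  have : u = p := norm_inj (F2_inv hg) ⟨q', e, h6, hu⟩ hn (hpu.symm.trans hpn)
  subst this
  by_cases hle : u.length ≤ fll g c'
  · exact ⟨(F2_low hg h7 h8 hle).1 hu, hle, hp⟩
  · exfalso
    have h9 := (F2_low hg h1 rfl h4).2 h3
    have := FL hg h7 h1 h8 rfl (by omega) hu h9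
    have := congrArg List.length this
    rw [List.length_take, List.length_take] at this
    have := fll_le hg h1
    have := fll_le hg h7
    omega

lemma next_inv {n : ℕ} (hn : n = Fintype.card Q) {ν : Q → ℕ} {R : Q → Q → Prop}
    (hf : Inv K n f) (hν : ∀ q, n ≤ ν q) (h0 : 0 < n) (hinj : Function.Injective ν) :
    Inv K n (F3 (F2 K (F1 K ν R f))) := by
  subst hn
  exact F3_inv (F2_inv (F1_inv hf hν h0 hinj)) (fun u e h => F2_nz (F1_inv hf hν h0 hinj) h)

end SD

namespace SD
variable {Q : Type}

lemma konig [Finite Q] (V : ℕ → Q → Prop) (T : ℕ → Q → Q → Prop)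
    (hne : ∀ i, ∃ q, V i q) (hT : ∀ i q', V (i + 1) q' → ∃ q, V i q ∧ T i q q') :
    ∃ ρ : ℕ → Q, ∀ i, V i (ρ i) ∧ T i (ρ i) (ρ (i + 1)) := by
  have path : ∀ n q, V n q → ∃ σ : ℕ → Q, σ n = q ∧ (∀ i ≤ n, V i (σ i)) ∧
      ∀ i < n, T i (σ i) (σ (i + 1)) := by
    intro n
    induction n with
    | zero => exact fun q hq => ⟨fun _ => q, rfl, fun i hi => by
        obtain rfl : i = 0 := by omega
        exact hq, fun i hi => by omega⟩
    | succ n ih =>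
      intro q' hq'
      obtain ⟨q, hq, hT'⟩ := hT n q' hq'
      obtain ⟨σ, h1, h2, h3⟩ := ih q hq
      refine ⟨fun i => if i ≤ n then σ i else q', by simp, ?_, ?_⟩
      · intro i hi
        by_cases h : i ≤ n
        · simpa [h] using h2 i h
        · obtain rfl : i = n + 1 := by omega
          simpa using hq'
      · intro i hi
        by_cases h : i + 1 ≤ n
        · have : i ≤ n := by omega
          simpa [h, this] using h3 i (by omega)
        · obtain rfl : i = n := by omega
          simpa [h1] using hT'
  choose a ha using hne
  choose σ h1 h2 h3 using fun n => path n (a n) (ha n)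
  have lim : ∀ i, ∃ q, ∀ᶠ n in (Filter.hyperfilter ℕ : Filter ℕ), σ n i = q := by
    intro i
    obtain ⟨q, hq⟩ := Ultrafilter.eq_pure_of_finite ((Filter.hyperfilter ℕ).map (fun n => σ n i))
    refine ⟨q, ?_⟩
    have : ({q} : Set Q) ∈ (Filter.hyperfilter ℕ).map (fun n => σ n i) := by
      rw [hq]; simp
    exact this
  choose ρ hρ using lim
  refine ⟨ρ, fun i => ?_⟩
  have hge : ∀ᶠ n in (Filter.hyperfilter ℕ : Filter ℕ), i + 1 ≤ n := by
    have := Filter.hyperfilter_le_cofinite (α := ℕ)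
    rw [Nat.cofinite_eq_atTop] at this
    exact this (Filter.eventually_ge_atTop (i + 1))
  obtain ⟨n, e1, e2, e3⟩ := ((hρ i).and ((hρ (i + 1)).and hge)).exists
  rw [← e1, ← e2]
  exact ⟨h2 n i (by omega), h3 n i (by omega)⟩

lemma ev_const (a : ℕ → ℕ) (M : ℕ) (h : ∀ i ≥ M, a (i + 1) ≤ a i) : ∃ J M', M ≤ M' ∧ ∀ i ≥ M', a i = J := by
  classical
  have hne : ∃ v, ∃ i ≥ M, a i = v := ⟨_, M, le_rfl, rfl⟩
  obtain ⟨i, hi, hv⟩ := Nat.find_spec hne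
  refine ⟨Nat.find hne, i, hi, fun k hk => ?_⟩
  induction k, hk using Nat.le_induction with
  | base => exact hv
  | succ k hk ih =>
    have h1 := h k (by omega)
    have h2 := Nat.find_min' hne ⟨k + 1, by omega, rfl⟩
    omega

variable [Fintype Q]

structure Rn (K : Skel Q) (N : ℕ) (ν : Q → ℕ) (R : ℕ → Q → Q → Prop) (f : ℕ → Conf Q) : Prop where
  step : ∀ i, f (i + 1) = F3 (F2 K (F1 K ν (R i) (f i)))
  inv : ∀ i, Inv K N (f i)
  nu : ∀ q, N ≤ ν q
  pre : ∀ i, PreInv K (F1 K ν (R i) (f i))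

/-- abstract acceptance of the deterministic automaton -/
def AccD (K : Skel Q) (ν : Q → ℕ) (R : ℕ → Q → Q → Prop) (f : ℕ → Conf Q) : Prop :=
  ∃ c t, (∀ M, ∃ i ≥ M, ∃ q l, f (i + 1) q = some l ∧
      lst (l.take (flq (F1 K ν (R i) (f i)) q)) = c ∧ lev (l.take (flq (F1 K ν (R i) (f i)) q)) = t) ∧
    ∃ M, ∀ i ≥ M, ∃ q p, stab K (F1 K ν (R i) (f i)) p q ∧ lst p = c ∧ lev p = t

variable {K : Skel Q} {N : ℕ} {ν : Q → ℕ} {R : ℕ → Q → Q → Prop} {f : ℕ → Conf Q}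

lemma Rn.small (h : Rn K N ν R f) {i : ℕ} {p : Code} (hp : nd (f i) p) : ∀ e ∈ p, e.2 < N := by
  obtain ⟨q, l, h1, h2⟩ := hp
  intro e he
  exact (h.inv i).lt' h1 e (h2.subset he)

lemma Rn.stab_nd (h : Rn K N ν R f) {i : ℕ} {p : Code} {q : Q}
    (hp : stab K (F1 K ν (R i) (f i)) p q) : nd (f (i + 1)) p := by
  obtain ⟨c, d, h1, h2, h3, h4, h5⟩ := hp
  rw [← h.step] at h2
  exact ⟨q, d, h2, h5⟩

lemma Rn.stab_old (h : Rn K N ν R f) {i : ℕ} {p : Code} {q' : Q}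
    (hp : stab K (F1 K ν (R i) (f i)) p q') :
    ∃ q l c, R i q q' ∧ f i q = some l ∧ F1 K ν (R i) (f i) q' = some c ∧
      c = trans K q' (ν q') Finset.univ l ∧ p <+: l ∧ p <+: c ∧
      q' ∈ sat K Finset.univ p := by
  have h0 := h.stab_nd hp
  obtain ⟨c, d, h1, h2, h3, h4, h5⟩ := hp
  obtain ⟨q, l, a1, a2, a3, a4, a5⟩ := F1_old h.nu h1 h3 (h.small h0)
  exact ⟨q, l, c, a1, a2, h1, a3, a4, h3, a5⟩

/-- one step head of trans -/
lemma trans_head (K : Skel Q) (q : Q) (n : ℕ) (S : Finset Q) (x : ℕ × ℕ) (t : Code) :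
    ∃ z t', trans K q n S (x :: t) = z :: t' ∧ (q ∈ K.nx S x.1 → z = x) ∧
      (q ∉ K.nx S x.1 → q ∉ K.β S x.1 → z.1 = x.1) ∧
      (q ∉ K.nx S x.1 → q ∈ K.β S x.1 → z.1 = x.1 - 1) := by
  rw [trans]
  split_ifs with h1 h2
  · exact ⟨_, _, rfl, fun _ => rfl, fun h => (h h1).elim, fun h => (h h1).elim⟩
  · exact ⟨_, _, rfl, fun h => (h1 h).elim, fun _ h => (h h2).elim, fun _ _ => rfl⟩
  · exact ⟨_, _, rfl, fun h => (h1 h).elim, fun _ _ => rfl, fun _ h => (h2 h).elim⟩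

theorem soundness (h : Rn K N ν R f) (hA : AccD K ν R f) :
    ∃ (ρ : ℕ → Q) (S : Finset Q), (∃ l, f 0 (ρ 0) = some l) ∧ (∀ i, R i (ρ i) (ρ (i + 1))) ∧
      (∃ M, ∀ i ≥ M, ρ i ∈ S) ∧ ∀ j, j ≠ 0 → j ≤ K.r S → ∀ M, ∃ i ≥ M, ρ i ∈ K.β S j := by
  obtain ⟨c, t, hG, M, hB⟩ := hA
  -- the constant node
  obtain ⟨q0, p, hs0, hc, ht⟩ := hB M le_rfl
  have hst : ∀ i ≥ M, ∃ q, stab K (F1 K ν (R i) (f i)) p q := by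
    intro i hi
    induction i, hi using Nat.le_induction with
    | base => exact ⟨q0, hs0⟩
    | succ i hi ih =>
      obtain ⟨q, hq⟩ := ih
      obtain ⟨q', p', hs, hc', ht'⟩ := hB (i + 1) (by omega)
      obtain ⟨q1, l1, c1, a1, a2, a3, a4, a5, a6, a7⟩ := h.stab_old hs
      have := name_inj (h.inv (i + 1)).toPreInv (h.stab_nd hq) ⟨q1, l1, a2, a5⟩
        (hc.trans hc'.symm) (ht.trans ht'.symm)
      subst this
      exact ⟨q', hs⟩
  have hst' : ∀ i ≥ M, ∀ q l, f (i + 1) q = some l → p <+: l →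
      stab K (F1 K ν (R i) (f i)) p q := by
    intro i hi q l hl hp
    obtain ⟨q', hq'⟩ := hst i hi
    rw [h.step] at hl
    exact UL (h.pre i) hq' hl hp
  -- run
  let V : ℕ → Q → Prop := fun i q => ∃ l, f i q = some l ∧ (M < i → p <+: l)
  let T : ℕ → Q → Q → Prop := fun i q q' => R i q q' ∧ ∃ l c, f i q = some l ∧
    F1 K ν (R i) (f i) q' = some c ∧ c = trans K q' (ν q') Finset.univ l
  have hV : ∀ i q', V (i + 1) q' → ∃ q, V i q ∧ T i q q' := by
    rintro i q' ⟨l, h1, h2⟩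
    by_cases hi : M ≤ i
    · obtain ⟨q1, l1, c1, a1, a2, a3, a4, a5, a6, a7⟩ := h.stab_old (hst' i hi q' l h1 (h2 (by omega)))
      exact ⟨q1, ⟨l1, a2, fun _ => a5⟩, a1, l1, c1, a2, a3, a4⟩
    · rw [h.step] at h1
      obtain ⟨c, h3, -⟩ := next_some' h1
      obtain ⟨⟨q, l1, a1, a2, a3⟩, -⟩ := F1_spec K ν (R i) (f i) h3
      exact ⟨q, ⟨l1, a2, fun hh => by omega⟩, a1, l1, c, a2, h3, a3⟩
  have hne : ∀ i, ∃ q, V i q := by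
    have big : ∀ i ≥ M, ∃ q, V (i + 1) q := by
      intro i hi
      obtain ⟨q, hq⟩ := hst i hi
      obtain ⟨q, l, h1, h2⟩ := h.stab_nd hq
      exact ⟨q, l, h1, fun _ => h2⟩
    have down : ∀ k i, (∃ q, V (i + k) q) → ∃ q, V i q := by
      intro k
      induction k with
      | zero => exact fun i hi => hi
      | succ k ih =>
        rintro i ⟨q', hq'⟩
        obtain ⟨q, hq, -⟩ := hV (i + k) q' hq'
        exact ih i ⟨q, hq⟩
    intro i
    apply down (M + 1)
    exact big (i + M) (by omega)
  obtain ⟨ρ, hρ⟩ := konig V T hne hV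
  refine ⟨ρ, sat K Finset.univ p, ?_, fun i => (hρ i).2.1, ⟨M + 1, ?_⟩, ?_⟩
  · obtain ⟨l, hl, -⟩ := (hρ 0).1
    exact ⟨l, hl⟩
  · intro i hi
    obtain ⟨i, rfl⟩ : ∃ i', i = i' + 1 := ⟨i - 1, by omega⟩
    obtain ⟨l, hl, hp⟩ := (hρ (i + 1)).1
    obtain ⟨q1, l1, c1, a1, a2, a3, a4, a5, a6, a7⟩ := h.stab_old (hst' i (by omega) _ l hl (hp (by omega)))
    exact a7
  · intro j hj0 hjr M1
    by_contra hcon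
    push Not at hcon
    set S := sat K Finset.univ p with hS
    have hr : K.r S ≠ 0 := by omega
    -- flashes of p
    have hfl : ∀ M2, ∃ i ≥ M2, flash (F1 K ν (R i) (f i)) p := by
      intro M2
      obtain ⟨i, hi, q, l, h1, h2, h3⟩ := hG (max M M2)
      refine ⟨i, (le_max_right _ _).trans hi, ?_⟩
      have hi' : M ≤ i := (le_max_left _ _).trans hi
      obtain ⟨q', hq'⟩ := hst i hi'
      have h4 := name_inj (h.inv (i + 1)).toPreInv (h.stab_nd hq') ⟨q, l, h1, List.take_prefix _ _⟩
        (hc.trans h2.symm) (ht.trans h3.symm)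
      have h5 := hst' i hi' q l h1 (h4 ▸ List.take_prefix _ _)
      obtain ⟨c', d, b1, b2, b3, b4, b5⟩ := h5
      have h6 : flq (F1 K ν (R i) (f i)) q = fll (F1 K ν (R i) (f i)) c' := by simp [flq, b1]
      rw [h6] at h4
      have h7 := fll_flash (h.pre i) b1
      have h8 : p.length ≤ fll (F1 K ν (R i) (f i)) c' := b4
      have h9 : p = c'.take (fll (F1 K ν (R i) (f i)) c') := by
        have e1 := List.prefix_of_prefix_length_le b3 (List.take_prefix (fll (F1 K ν (R i) (f i)) c') c')
          (by rw [List.length_take]; have := fll_le (h.pre i) b1; omega)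
        apply e1.eq_of_length
        have e2 : l.length = c'.length ∨ fll (F1 K ν (R i) (f i)) c' ≤ l.length := by
          right
          rw [h.step, next_some b1] at h1
          rw [← Option.some.inj h1, norm_length, List.length_append, List.length_take]
          have := fll_le (h.pre i) b1
          omega
        have e3 := congrArg List.length h4
        rw [List.length_take] at e3 ⊢
        have := fll_le (h.pre i) b1
        omega
      rw [← h9] at h7
      exact h7
    -- analysis of a step
    have hstep : ∀ i > M, ∃ x t y t' l c, f i (ρ i) = some l ∧ l = p ++ x :: t ∧
        F1 K ν (R i) (f i) (ρ (i + 1)) = some c ∧ c = p ++ y :: t' ∧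
        (y.1 = x.1 ∨ (ρ (i + 1) ∈ K.β S x.1 ∧ y.1 = x.1 - 1)) := by
      intro i hi
      obtain ⟨-, -, l, c, h1, h2, h3⟩ := hρ i
      obtain ⟨l', h1', hp⟩ := (hρ i).1
      rw [h1] at h1'; cases h1'
      obtain ⟨x, rfl⟩ := hp hi
      have hv := valid_append K _ _ _ ((h.inv i).val _ _ h1)
      cases x with
      | nil => exact (hr hv).elim
      | cons x t =>
        have hmem : ρ (i + 1) ∈ sat K Finset.univ p := by
          obtain ⟨l, hl, hp⟩ := (hρ (i + 1)).1
          obtain ⟨q1, l1, c1, a1, a2, a3, a4, a5, a6, a7⟩ := h.stab_old (hst' i (by omega) _ l hl (hp (by omega)))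
          exact a7
        rw [trans_append K _ _ _ _ _ hmem] at h3
        obtain ⟨z, t', hz, z1, z2, z3⟩ := trans_head K (ρ (i + 1)) (ν (ρ (i + 1))) S x t
        rw [hz] at h3
        refine ⟨x, t, z, t', _, c, h1, rfl, h2, h3, ?_⟩
        by_cases e1 : ρ (i + 1) ∈ K.nx S x.1
        · left; rw [z1 e1]
        · by_cases e2 : ρ (i + 1) ∈ K.β S x.1
          · right; exact ⟨e2, z3 e1 e2⟩
          · left; exact z2 e1 e2
    -- next configuration
    have hnext : ∀ i ≥ M, ∀ c, F1 K ν (R i) (f i) (ρ (i + 1)) = some c →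
        (flash (F1 K ν (R i) (f i)) p → ∃ x t, f (i + 1) (ρ (i + 1)) = some (p ++ x :: t) ∧ x.1 = K.r S) ∧
        (¬ flash (F1 K ν (R i) (f i)) p → ∀ y t', c = p ++ y :: t' →
          ∃ x t, f (i + 1) (ρ (i + 1)) = some (p ++ x :: t) ∧ x.1 = y.1) := by
      intro i hi c hcc
      obtain ⟨l, hl, hp⟩ := (hρ (i + 1)).1
      have hs := hst' i hi _ l hl (hp (by omega))
      have hpn := (stab_norm (h.pre i) hs).2
      obtain ⟨c', d, b1, b2, b3, b4, b5⟩ := hs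
      rw [hcc] at b1; cases b1
      have hle := fll_le (h.pre i) hcc
      constructor
      · intro hf
        have h1 := fll_min b3 hf
        have h2 : c.take (fll (F1 K ν (R i) (f i)) c) = p := by
          rw [show fll (F1 K ν (R i) (f i)) c = p.length by omega]
          exact (List.prefix_iff_eq_take.1 b3).symm
        obtain ⟨t, ht⟩ := zext_head K S hr
        rw [h.step, next_some hcc, h2, norm_append, ← hpn, ← hS, ht]
        exact ⟨_, _, rfl, rfl⟩
      · intro hf y t' hy
        have hlt : p.length < fll (F1 K ν (R i) (f i)) c := by
          rcases Nat.lt_or_ge p.length (fll (F1 K ν (R i) (f i)) c) with h1 | h1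
          · exact h1
          · exfalso
            have h2 : c.take (fll (F1 K ν (R i) (f i)) c) = p := by
              rw [show fll (F1 K ν (R i) (f i)) c = p.length by omega]
              exact (List.prefix_iff_eq_take.1 b3).symm
            have := fll_flash (h.pre i) hcc
            rw [h2] at this
            exact hf this
        obtain ⟨k, hk⟩ : ∃ k, fll (F1 K ν (R i) (f i)) c = p.length + (k + 1) :=
          ⟨fll (F1 K ν (R i) (f i)) c - p.length - 1, by omega⟩
        have h2 : c.take (fll (F1 K ν (R i) (f i)) c) = p ++ y :: t'.take k := by
          rw [hk, hy, List.take_length_add_append, List.take_succ_cons]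
        rw [h.step, next_some hcc, h2, List.append_assoc, norm_append, ← hpn]
        exact ⟨_, _, rfl, rfl⟩
    obtain ⟨i0, hi0, hf0⟩ := hfl (max (M + 1) M1)
    have hi0' : M < i0 := lt_of_lt_of_le (by omega) ((le_max_left (M + 1) M1).trans hi0)
    have hi1' : M1 ≤ i0 := (le_max_right _ _).trans hi0
    have main : ∀ i > i0, ∃ x t, f i (ρ i) = some (p ++ x :: t) ∧ j ≤ x.1 := by
      intro i hi
      induction i, hi using Nat.le_induction with
      | base =>
        obtain ⟨x, t, y, t', l, c, h1, h2, h3, h4, h5⟩ := hstep i0 hi0'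
        obtain ⟨x, t, h6, h7⟩ := (hnext i0 hi0'.le c h3).1 hf0
        exact ⟨x, t, h6, by omega⟩
      | succ i hi ih =>
        obtain ⟨x, t, y, t', l, c, h1, h2, h3, h4, h5⟩ := hstep i (by omega)
        obtain ⟨x', t'', h6, h7⟩ := ih
        rw [h1, h2] at h6
        have h8 := Option.some.inj h6
        rw [List.append_cancel_left_eq] at h8
        obtain ⟨rfl, rfl⟩ := List.cons.inj h8
        have hy : j ≤ y.1 := by
          rcases h5 with h5 | ⟨h5, h5'⟩
          · omega
          · rcases Nat.lt_or_ge j x.1 with h9 | h9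
            · omega
            · obtain rfl : j = x.1 := by omega
              exact (hcon (i + 1) (by omega) h5).elim
        have hnf : ¬ flash (F1 K ν (R i) (f i)) p := by
          intro hf
          have := hf (ρ (i + 1)) c y h3 (by rw [h4]; exact ⟨t', by simp⟩)
          omega
        obtain ⟨x2, t2, h9, h10⟩ := (hnext i (by omega) c h3).2 hnf y t' h4
        exact ⟨x2, t2, h9, by omega⟩
    obtain ⟨i1, hi1, hf1⟩ := hfl (i0 + 1)
    obtain ⟨x, t, y, t', l, c, h1, h2, h3, h4, h5⟩ := hstep i1 (by omega)
    obtain ⟨x', t'', h6, h7⟩ := main i1 (by omega)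
    rw [h1, h2] at h6
    have h8 := Option.some.inj h6
    rw [List.append_cancel_left_eq] at h8
    obtain ⟨rfl, rfl⟩ := List.cons.inj h8
    have hy0 := hf1 (ρ (i1 + 1)) c y h3 (by rw [h4]; exact ⟨t', by simp⟩)
    rcases h5 with h5 | ⟨h5, h5'⟩
    · omega
    · obtain rfl : j = x.1 := by omega
      exact hcon (i1 + 1) (by omega) h5

end SD

namespace SD
variable {Q : Type} [Fintype Q]
variable {K : Skel Q} {N : ℕ} {ν : Q → ℕ} {R : ℕ → Q → Q → Prop} {f : ℕ → Conf Q}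

theorem completeness (h : Rn K N ν R f) (hdis : ∀ S j, j ≠ 0 → j ≤ K.r S → ∀ q ∈ K.β S j, q ∉ K.nx S j)
    (ρ : ℕ → Q) (h0 : ∃ l, f 0 (ρ 0) = some l) (hR : ∀ i, R i (ρ i) (ρ (i + 1)))
    (hC : ∀ S j, j ≠ 0 → j ≤ K.r S → (∃ M, ∀ i ≥ M, ρ i ∈ S) → (∃ M, ∀ i ≥ M, ρ i ∉ K.β S j) →
      ∃ M, ∀ i ≥ M, ρ i ∈ K.nx S j) : AccD K ν R f := by
  classical
  -- alive
  have halive : ∀ i, ∃ l, f i (ρ i) = some l := by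
    intro i
    induction i with
    | zero => exact h0
    | succ i ih =>
      obtain ⟨l, hl⟩ := ih
      obtain ⟨c, hc⟩ := F1_some K ν (R i) (f i) (hR i) hl
      rw [h.step, next_some hc]
      exact ⟨_, rfl⟩
  choose l hl using halive
  choose c hc using fun i => F1_some K ν (R i) (f i) (hR i) (hl i)
  have hlen : ∀ i, (l i).length ≤ K.dep Finset.univ + N := fun i => length_le (h.inv i) (hl i)
  have hnx : ∀ i, l (i + 1) = norm (lab (F2 K (F1 K ν (R i) (f i)))) []
      ((c i).take (fll (F1 K ν (R i) (f i)) (c i)) ++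
        zext K (sat K Finset.univ ((c i).take (fll (F1 K ν (R i) (f i)) (c i))))) := by
    intro i
    have := next_some (K := K) (hc i)
    rw [← h.step, hl (i + 1)] at this
    exact Option.some.inj this
  -- stable nodes
  let P : Code → Prop := fun p => ∃ M, ∀ i ≥ M, stab K (F1 K ν (R i) (f i)) p (ρ (i + 1))
  have hstab : ∀ p i, stab K (F1 K ν (R i) (f i)) p (ρ (i + 1)) ↔
      (p <+: c i ∧ p.length ≤ fll (F1 K ν (R i) (f i)) (c i) ∧ p <+: l (i + 1)) := by
    intro p i
    constructor
    · rintro ⟨c', d, b1, b2, b3, b4, b5⟩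
      rw [hc i] at b1; cases b1
      rw [← h.step, hl (i + 1)] at b2; cases b2
      exact ⟨b3, b4, b5⟩
    · rintro ⟨b3, b4, b5⟩
      exact ⟨c i, l (i + 1), hc i, by rw [← h.step]; exact hl (i + 1), b3, b4, b5⟩
  have hPnil : P [] := ⟨0, fun i _ => (hstab _ _).2 ⟨by simp, by simp, by simp⟩⟩
  have hPlen : ∀ p, P p → p.length ≤ K.dep Finset.univ + N := by
    rintro p ⟨M, hM⟩
    exact (((hstab p M).1 (hM M le_rfl)).2.2.length_le).trans (hlen _)
  obtain ⟨p, hp, hmax⟩ : ∃ p, P p ∧ ∀ p', P p' → p'.length ≤ p.length := by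
    let W : ℕ → Prop := fun k => ∃ p, P p ∧ p.length = k
    have hW : W (Nat.findGreatest W (K.dep Finset.univ + N)) :=
      Nat.findGreatest_spec (m := 0) (Nat.zero_le _) ⟨[], hPnil, rfl⟩
    obtain ⟨p, hp, hpl⟩ := hW
    refine ⟨p, hp, fun p' hp' => ?_⟩
    rw [hpl]
    exact Nat.le_findGreatest (hPlen p' hp') ⟨p', hp', rfl⟩
  obtain ⟨M, hM⟩ := hp
  refine ⟨lst p, lev p, ?_, M, fun i hi => ⟨_, p, hM i hi, rfl, rfl⟩⟩
  by_contra hcon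
  push Not at hcon
  obtain ⟨M1, hM1⟩ := hcon
  -- eventually no flash at p
  have hlt : ∀ i ≥ max M M1, p.length < fll (F1 K ν (R i) (f i)) (c i) := by
    intro i hi
    have hi1 : M ≤ i := (le_max_left _ _).trans hi
    have hi2 : M1 ≤ i := (le_max_right _ _).trans hi
    obtain ⟨b3, b4, b5⟩ := (hstab p i).1 (hM i hi1)
    refine lt_of_le_of_ne b4 fun heq => ?_
    have h1 : flq (F1 K ν (R i) (f i)) (ρ (i + 1)) = p.length := by simp [flq, hc i, heq]
    have h2 := hM1 i hi2 (ρ (i + 1)) (l (i + 1)) (hl (i + 1))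
    rw [h1, ← List.prefix_iff_eq_take.1 b5] at h2
    exact h2 rfl rfl
  set M2 := max M M1 with hM2
  have hM2M : M ≤ M2 := le_max_left _ _
  set S := sat K Finset.univ p with hS
  have hsat : ∀ i ≥ M2, ρ (i + 1) ∈ S := by
    intro i hi
    obtain ⟨q1, l1, c1, a1, a2, a3, a4, a5, a6, a7⟩ := h.stab_old (hM i (by omega))
    exact a7
  have hy : ∀ i, ∃ y t, i ≥ M2 → c i = p ++ y :: t ∧
      ∃ t', l (i + 1) = p ++ (y.1, lab (F2 K (F1 K ν (R i) (f i))) p y) :: t' := by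
    intro i
    by_cases hi : i ≥ M2
    · have hs := hM i (by omega)
      have hpn := (stab_norm (h.pre i) hs).2
      obtain ⟨⟨t, ht⟩, b4, b5⟩ := (hstab p i).1 hs
      have hlt' := hlt i hi
      have hle := fll_le (h.pre i) (hc i)
      cases t with
      | nil =>
        rw [List.append_nil] at ht
        rw [← ht] at hlt' hle
        omega
      | cons y t =>
        refine ⟨y, t, fun _ => ⟨ht.symm, ?_⟩⟩
        obtain ⟨k, hk⟩ : ∃ k, fll (F1 K ν (R i) (f i)) (c i) = p.length + (k + 1) :=
          ⟨fll (F1 K ν (R i) (f i)) (c i) - p.length - 1, by omega⟩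
        have h2 : (c i).take (fll (F1 K ν (R i) (f i)) (c i)) = p ++ y :: t.take k := by
          rw [hk, ← ht, List.take_length_add_append, List.take_succ_cons]
        rw [hnx, h2, List.append_assoc, norm_append, ← hpn]
        exact ⟨_, rfl⟩
    · exact ⟨(0, 0), [], fun hh => (hi hh).elim⟩
  choose y t hyt using hy
  let x : ℕ → ℕ × ℕ := fun i => ((y (i - 1)).1, lab (F2 K (F1 K ν (R (i - 1)) (f (i - 1)))) p (y (i - 1)))
  have hx : ∀ i ≥ M2, ∃ t', l (i + 1) = p ++ x (i + 1) :: t' := fun i hi => (hyt i hi).2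
  have hx1 : ∀ i, (x (i + 1)).1 = (y i).1 := fun i => rfl
  have hx2 : ∀ i, (x (i + 1)).2 ≤ (y i).2 := fun i => lab_le _ _
  have hxr : ∀ i ≥ M2 + 1, (x i).1 ≤ K.r S := by
    intro i hi
    obtain ⟨i, rfl⟩ : ∃ k, i = k + 1 := ⟨i - 1, by omega⟩
    obtain ⟨t', ht⟩ := hx i (by omega)
    have := (h.inv (i + 1)).val _ _ (hl (i + 1))
    rw [ht] at this
    exact (valid_append K _ _ _ this).2.1
  have hstep : ∀ i ≥ M2 + 1, ∃ z, toLex (y i) ≤ toLex z ∧ (ρ (i + 1) ∈ K.nx S (x i).1 → z = x i) ∧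
      (ρ (i + 1) ∉ K.nx S (x i).1 → ρ (i + 1) ∉ K.β S (x i).1 → z.1 = (x i).1) ∧
      (ρ (i + 1) ∉ K.nx S (x i).1 → ρ (i + 1) ∈ K.β S (x i).1 → z.1 = (x i).1 - 1) := by
    intro i hi
    obtain ⟨t', ht⟩ : ∃ t', l i = p ++ x i :: t' := by
      obtain ⟨i, rfl⟩ : ∃ k, i = k + 1 := ⟨i - 1, by omega⟩
      exact hx i (by omega)
    obtain ⟨z, t2, hz, z1, z2, z3⟩ := trans_head K (ρ (i + 1)) (ν (ρ (i + 1))) S (x i) t'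
    refine ⟨z, ?_, z1, z2, z3⟩
    have h1 := (F1_spec K ν (R i) (f i) (hc i)).2 _ ⟨ρ i, l i, hR i, hl i, rfl⟩
    rw [ht, trans_append K _ _ _ _ _ (hsat i (by omega)), ← hS, hz, (hyt i (by omega)).1] at h1
    exact key_le h1
  have hfst : ∀ a b : ℕ × ℕ, toLex a ≤ toLex b → a.1 ≤ b.1 ∧ (a.1 = b.1 → a.2 ≤ b.2) := by
    intro a b hab
    rw [Prod.Lex.toLex_le_toLex] at hab
    rcases hab with h1 | ⟨h1, h2⟩
    · exact ⟨h1.le, fun h3 => by omega⟩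
    · exact ⟨h1.le, fun _ => h2⟩
  have hyx : ∀ i ≥ M2 + 1, (y i).1 ≤ (x i).1 := by
    intro i hi
    obtain ⟨z, h1, z1, z2, z3⟩ := hstep i hi
    have h2 := (hfst _ _ h1).1
    by_cases e1 : ρ (i + 1) ∈ K.nx S (x i).1
    · rw [← z1 e1]; exact h2
    · by_cases e2 : ρ (i + 1) ∈ K.β S (x i).1
      · have := z3 e1 e2; omega
      · have := z2 e1 e2; omega
  obtain ⟨J, M3, hM3, hJ⟩ := ev_const (fun i => (x i).1) (M2 + 1) (fun i hi => by
    have := hyx i hi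
    have := hx1 i
    omega)
  have hyJ : ∀ i ≥ M3, (y i).1 = J := fun i hi => (hx1 i).symm.trans (hJ (i + 1) (by omega))
  have hin : ∃ M4 ≥ M3, ∀ i ≥ M4, ρ (i + 1) ∈ K.nx S J := by
    by_cases hJ0 : J = 0
    · refine ⟨M3, le_rfl, fun i hi => ?_⟩
      rw [hJ0, K.nx_zero]
      exact hsat i (by omega)
    · have hJr : J ≤ K.r S := by
        rw [← hJ M3 le_rfl]; exact hxr M3 hM3
      have : ∃ M, ∀ i ≥ M, ρ i ∉ K.β S J := by
        refine ⟨M3 + 1, fun i hi hb => ?_⟩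
        obtain ⟨i, rfl⟩ : ∃ k, i = k + 1 := ⟨i - 1, by omega⟩
        obtain ⟨z, h1, z1, z2, z3⟩ := hstep i (by omega)
        rw [hJ i (by omega)] at z3
        have h2 := (hfst _ _ h1).1
        have h3 := z3 (hdis S J hJ0 hJr _ hb) hb
        have h4 := hyJ i (by omega)
        omega
      obtain ⟨M4, hM4⟩ := hC S J hJ0 hJr ⟨M2 + 1, fun i hi => by
        obtain ⟨i, rfl⟩ : ∃ k, i = k + 1 := ⟨i - 1, by omega⟩
        exact hsat i (by omega)⟩ this
      exact ⟨max M3 M4, le_max_left _ _, fun i hi => hM4 (i + 1)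
        (by have := le_max_right M3 M4; omega)⟩
  obtain ⟨M4, hM4, hin⟩ := hin
  have hy2 : ∀ i ≥ M4, (y i).2 ≤ (x i).2 := by
    intro i hi
    obtain ⟨z, h1, z1, z2, z3⟩ := hstep i (by omega)
    rw [hJ i (by omega)] at z1
    rw [z1 (hin i hi)] at h1
    exact (hfst _ _ h1).2 (by rw [hJ i (by omega), hyJ i (by omega)])
  obtain ⟨s, M5, hM5, hs⟩ := ev_const (fun i => (x i).2) M4 (fun i hi => (hx2 i).trans (hy2 i hi))
  have hP : P (p ++ [(J, s)]) := by
    refine ⟨M5, fun i hi => (hstab _ _).2 ⟨?_, ?_, ?_⟩⟩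
    · have : y i = (J, s) := by
        have a1 := hyJ i (by omega)
        have a2 := hy2 i (by omega)
        have a3 := hx2 i
        have a4 := hs i hi
        have a5 := hs (i + 1) (by omega)
        ext
        · exact a1
        · simp only; omega
      rw [(hyt i (by omega)).1, this]
      exact ⟨t i, by simp⟩
    · have := hlt i (by omega)
      simpa using this
    · obtain ⟨t', ht⟩ := hx i (by omega)
      have : x (i + 1) = (J, s) := by
        ext
        · exact hJ (i + 1) (by omega)
        · exact hs (i + 1) (by omega)
      rw [ht, this]
      exact ⟨t', by simp⟩
  have := hmax _ hP
  simp at this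

end SD

namespace SD
variable {Q : Type}

/-! ### counting -/
structure Good (K : Skel Q) : Prop where
  bsub : ∀ S j, j ≠ 0 → j ≤ K.r S → K.β S j ⊆ S
  dis : ∀ S j, j ≠ 0 → j ≤ K.r S → ∀ q ∈ K.β S j, q ∉ K.nx S j
  anti : ∀ S i j, i ≠ 0 → i ≤ K.r S → j ≠ 0 → j ≤ K.r S → K.β S i ⊆ K.β S j → i = j

def vch (K : Skel Q) : Finset Q → List ℕ → Prop
  | S, [] => K.r S = 0
  | S, j :: l => j ≠ 0 ∧ j ≤ K.r S ∧ vch K (K.nx S j) l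

lemma fact_lym (S : Finset Q) (I : Finset ℕ) (b : ℕ → Finset Q) (hb : ∀ j ∈ I, b j ⊆ S)
    (ha : ∀ i ∈ I, ∀ j ∈ I, b i ⊆ b j → i = j) :
    ∑ j ∈ I, (S.card - (b j).card).factorial ≤ S.card.factorial := by
  classical
  let b' : ℕ → Finset {x // x ∈ S} := fun j => (b j).subtype (· ∈ S)
  have hmap : ∀ j ∈ I, (b' j).map (Function.Embedding.subtype _) = b j := by
    intro j hj
    rw [Finset.subtype_map]
    exact Finset.filter_true_of_mem (fun x hx => hb j hj hx)
  have hcard : ∀ j ∈ I, (b' j).card = (b j).card := by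
    intro j hj
    rw [← hmap j hj, Finset.card_map]
  have hsub : ∀ i ∈ I, ∀ j ∈ I, b' i ⊆ b' j → i = j := by
    intro i hi j hj h
    apply ha i hi j hj
    rw [← hmap i hi, ← hmap j hj]
    exact Finset.map_subset_map.2 h
  have hlym := Finset.lubell_yamamoto_meshalkin_inequality_sum_inv_choose (𝕜 := ℚ) (𝒜 := I.image b') (by
    intro x hx y hy hxy hs
    rw [Finset.coe_image] at hx hy
    obtain ⟨i, hi, rfl⟩ := hx
    obtain ⟨j, hj, rfl⟩ := hy
    exact hxy (congrArg b' (hsub i hi j hj hs)))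
  rw [Finset.sum_image (fun i hi j hj h => hsub i hi j hj h.subset), Fintype.card_coe] at hlym
  have h1 : ∀ j ∈ I, ((S.card - (b j).card).factorial : ℚ) ≤
      S.card.factorial * ((S.card.choose (b' j).card : ℕ) : ℚ)⁻¹ := by
    intro j hj
    rw [hcard j hj]
    have hle := Finset.card_le_card (hb j hj)
    have hpos : (0 : ℚ) < (S.card.choose (b j).card : ℕ) := by exact_mod_cast Nat.choose_pos hle
    rw [← div_eq_mul_inv, le_div_iff₀ hpos]
    have h2 := Nat.choose_mul_factorial_mul_factorial hle
    have h3 : 1 ≤ (b j).card.factorial := Nat.factorial_pos _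
    have h4 : (S.card - (b j).card).factorial * S.card.choose (b j).card ≤ S.card.factorial := by
      rw [← h2]
      calc _ = S.card.choose (b j).card * 1 * (S.card - (b j).card).factorial := by ring
        _ ≤ _ := by gcongr
    exact_mod_cast h4
  have h2 : (∑ j ∈ I, ((S.card - (b j).card).factorial : ℚ)) ≤ S.card.factorial := by
    calc _ ≤ ∑ j ∈ I, (S.card.factorial * ((S.card.choose (b' j).card : ℕ) : ℚ)⁻¹) :=
          Finset.sum_le_sum h1
      _ = S.card.factorial * ∑ j ∈ I, ((S.card.choose (b' j).card : ℕ) : ℚ)⁻¹ := by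
          rw [Finset.mul_sum]
      _ ≤ S.card.factorial * 1 := by gcongr
      _ = _ := mul_one _
  exact_mod_cast h2

lemma chains_card (K : Skel Q) (hK : Good K) (S : Finset Q) :
    ∃ F : Finset (List ℕ), (∀ l, vch K S l → l ∈ F) ∧ F.card ≤ S.card.factorial := by
  classical
  induction' hd : K.dep S using Nat.strong_induction_on with d ih generalizing S
  subst hd
  by_cases hr : K.r S = 0
  · refine ⟨{[]}, ?_, ?_⟩
    · intro l hl
      cases l with
      | nil => simp
      | cons j l => have := hl.1; have := hl.2.1; omega
    · rw [Finset.card_singleton]; exact Nat.factorial_pos _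
  · have ih' : ∀ j, ∃ F : Finset (List ℕ), j ∈ Finset.Icc 1 (K.r S) → (∀ l, vch K (K.nx S j) l → l ∈ F) ∧
        F.card ≤ (K.nx S j).card.factorial := by
      intro j
      by_cases hj : j ∈ Finset.Icc 1 (K.r S)
      · rw [Finset.mem_Icc] at hj
        obtain ⟨F, hF⟩ := ih _ (K.dep_lt S j (by omega) hj.2) _ rfl
        exact ⟨F, fun _ => hF⟩
      · exact ⟨∅, fun h => (hj h).elim⟩
    choose F hF using ih'
    refine ⟨(Finset.Icc 1 (K.r S)).biUnion (fun j => (F j).image (j :: ·)), ?_, ?_⟩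
    · intro l hl
      cases l with
      | nil => exact (hr hl).elim
      | cons j l =>
        have hj : j ∈ Finset.Icc 1 (K.r S) := by
          rw [Finset.mem_Icc]; have := hl.1; have := hl.2.1; omega
        rw [Finset.mem_biUnion]
        exact ⟨j, hj, Finset.mem_image.2 ⟨l, (hF j hj).1 l hl.2.2, rfl⟩⟩
    · calc _ ≤ ∑ j ∈ Finset.Icc 1 (K.r S), ((F j).image (j :: ·)).card := Finset.card_biUnion_le
        _ ≤ ∑ j ∈ Finset.Icc 1 (K.r S), (S.card - (K.β S j).card).factorial := by
            apply Finset.sum_le_sum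
            intro j hj
            have h1 := (hF j hj).2
            rw [Finset.mem_Icc] at hj
            refine Finset.card_image_le.trans (h1.trans (Nat.factorial_le ?_))
            rw [← Finset.card_sdiff_of_subset (hK.bsub S j (by omega) hj.2)]
            apply Finset.card_le_card
            intro x hx
            rw [Finset.mem_sdiff]
            exact ⟨K.nx_sub S j hx, fun h => hK.dis S j (by omega) hj.2 x h hx⟩
        _ ≤ S.card.factorial := by
            apply fact_lym
            · intro j hj
              rw [Finset.mem_Icc] at hj
              exact hK.bsub S j (by omega) hj.2
            · intro i hi j hj h
              rw [Finset.mem_Icc] at hi hj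
              exact hK.anti S i j (by omega) hi.2 (by omega) hj.2 h

def chain (l : Code) : List ℕ := (l.map Prod.fst).filter (· ≠ 0)

lemma chain_vch (K : Skel Q) (S : Finset Q) (l : Code) (h : valid K S l) : vch K S (chain l) := by
  induction l generalizing S with
  | nil => exact h
  | cons e l ih =>
    have := ih _ h.2.2
    by_cases h0 : e.1 = 0
    · rw [h0, K.nx_zero] at this
      simpa [chain, h0] using this
    · have h2 : chain (e :: l) = e.1 :: chain l := by simp [chain, h0]
      rw [h2]
      exact ⟨h0, h.2.1, this⟩

lemma chain_append (u v : Code) : chain (u ++ v) = chain u ++ chain v := by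
  simp [chain]

lemma chain_zero (z : Code) (h : ∀ e ∈ z, e.1 ≠ 0) : chain z = z.map Prod.fst := by
  unfold chain
  rw [List.filter_eq_self]
  intro a ha
  obtain ⟨e, he, rfl⟩ := List.mem_map.1 ha
  simpa using h e he

lemma zero_eq (z z' : Code) (h : ∀ e ∈ z, e.2 = 0) (h' : ∀ e ∈ z', e.2 = 0)
    (hh : z.map Prod.fst = z'.map Prod.fst) : z = z' := by
  have key : ∀ z : Code, (∀ e ∈ z, e.2 = 0) → z = (z.map Prod.fst).map (fun j => (j, 0)) := by
    intro z hz
    rw [List.map_map]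
    conv_lhs => rw [← List.map_id z]
    apply List.map_congr_left
    intro e he
    ext
    · rfl
    · simpa using hz e he
  rw [key z h, key z' h', hh]

def hdr : Code → ℕ
  | [] => 0
  | e :: l => if e.2 = 0 then hdr l else l.length + 1
def hd (l : Code) : ℕ := hdr l.reverse

lemma hd_snoc (u : Code) (e : ℕ × ℕ) : hd (u ++ [e]) = if e.2 = 0 then hd u else u.length + 1 := by
  simp [hd, hdr]

lemma hd_le (l : Code) : hd l ≤ l.length := by
  induction l using List.reverseRecOn with
  | nil => simp [hd, hdr]
  | append_singleton u e ih => rw [hd_snoc]; split_ifs <;> simp; omega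

lemma hd_zero (w z : Code) (h : ∀ e ∈ z, e.2 = 0) : hd (w ++ z) = hd w := by
  induction z using List.reverseRecOn with
  | nil => simp
  | append_singleton u e ih =>
    rw [← List.append_assoc, hd_snoc, if_pos (h e (by simp))]
    exact ih (fun x hx => h x (by simp [hx]))

lemma lst_zero (w z : Code) (h : ∀ e ∈ z, e.2 = 0) : lst (w ++ z) = lst w := by
  induction z using List.reverseRecOn with
  | nil => simp
  | append_singleton u e ih =>
    rw [← List.append_assoc, lst_snoc, if_pos (h e (by simp))]
    exact ih (fun x hx => h x (by simp [hx]))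

lemma decomp (l : Code) : (hd l = 0 ∧ ∀ e ∈ l, e.2 = 0) ∨
    ∃ w e z, l = w ++ [e] ++ z ∧ e.2 ≠ 0 ∧ (∀ x ∈ z, x.2 = 0) ∧ hd l = w.length + 1 ∧ lst l = e.2 := by
  induction l using List.reverseRecOn with
  | nil => left; simp [hd, hdr]
  | append_singleton u e ih =>
    by_cases h0 : e.2 = 0
    · rw [hd_snoc, if_pos h0, lst_snoc, if_pos h0]
      rcases ih with ⟨h1, h2⟩ | ⟨w, e', z, h1, h2, h3, h4, h5⟩
      · left
        refine ⟨h1, ?_⟩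
        intro x hx
        rcases List.mem_append.1 hx with hx | hx
        · exact h2 x hx
        · rw [List.mem_singleton.1 hx]; exact h0
      · right
        refine ⟨w, e', z ++ [e], by rw [h1]; simp, h2, ?_, h4, h5⟩
        intro x hx
        rcases List.mem_append.1 hx with hx | hx
        · exact h3 x hx
        · rw [List.mem_singleton.1 hx]; exact h0
    · right
      exact ⟨u, e, [], by simp, h0, by simp, by rw [hd_snoc, if_neg h0], by rw [lst_snoc, if_neg h0]⟩

def bz (l : Code) : Bool := ((l.take (hd l)).getLast?).elim false (fun e => decide (e.1 = 0))

open Classical in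
noncomputable def rep (f : Conf Q) (q : Q) (l : Code) : Q :=
  if h : ∃ q' z, f q' = some (l.take (hd l - 1) ++ z) ∧ ∀ e ∈ z, e.2 = 0 then h.choose else q

noncomputable def enc (f : Conf Q) (q : Q) : Option (List ℕ × Q × ℕ × ℕ × Bool) :=
  (f q).map fun l => (chain l, rep f q l, hd l, lst l, bz l)

variable [Fintype Q] {K : Skel Q} {N : ℕ}

lemma rep_spec {f : Conf Q} (hf : Inv K N f) {q : Q} {l : Code} (h : f q = some l) :
    ∃ z, f (rep f q l) = some (l.take (hd l - 1) ++ z) ∧ ∀ e ∈ z, e.2 = 0 := by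
  have h1 := hf.ext (l.take (hd l - 1)) ⟨q, l, h, List.take_prefix _ _⟩
  unfold rep
  rw [dif_pos h1]
  exact h1.choose_spec

lemma enc_inj_aux {f f' : Conf Q} (hf : Inv K N f) (hf' : Inv K N f') (h : ∀ q, enc f q = enc f' q)
    (k : ℕ) : ∀ q l, f q = some l → hd l = k → f' q = some l := by
  induction' k using Nat.strong_induction_on with k ih
  intro q l hl hk
  have hq := h q
  unfold enc at hq
  rw [hl, Option.map_some] at hq
  obtain ⟨l', hl', hq⟩ := Option.map_eq_some_iff.1 hq.symm
  simp only [Prod.mk.injEq] at hq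
  obtain ⟨e1, e2, e3, e4, e5⟩ := hq
  have nz : ∀ e ∈ l, e.2 = 0 → e.1 ≠ 0 := fun e he => by
    obtain ⟨u, hu⟩ := mem_split_prefix he
    exact hf.z1 u e ⟨q, l, hl, hu⟩
  have nz' : ∀ e ∈ l', e.2 = 0 → e.1 ≠ 0 := fun e he => by
    obtain ⟨u, hu⟩ := mem_split_prefix he
    exact hf'.z1 u e ⟨q, l', hl', hu⟩
  rw [hl']
  congr 1
  rcases decomp l with ⟨a1, a2⟩ | ⟨w, e, z, a1, a2, a3, a4, a5⟩
  · rcases decomp l' with ⟨b1, b2⟩ | ⟨w', e', z', b1, b2, b3, b4, b5⟩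
    · apply zero_eq _ _ b2 a2
      rw [← chain_zero _ (fun e he => nz e he (a2 e he)), ← chain_zero _ (fun e he => nz' e he (b2 e he))]
      exact e1
    · omega
  · rcases decomp l' with ⟨b1, b2⟩ | ⟨w', e', z', b1, b2, b3, b4, b5⟩
    · omega
    · obtain ⟨y, hy1, hy2⟩ := rep_spec hf hl
      obtain ⟨y', hy1', hy2'⟩ := rep_spec hf' hl'
      rw [e2] at hy1'
      have t1 : l.take (hd l - 1) = w := by
        rw [a4, a1]; simp
      have t1' : l'.take (hd l' - 1) = w' := by
        rw [b4, b1]; simp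
      have s1 : l.take (hd l) = w ++ [e] := by
        rw [a4, a1]; simp [List.take_append]
      have s1' : l'.take (hd l') = w' ++ [e'] := by
        rw [b4, b1]; simp [List.take_append]
      rw [t1] at hy1
      rw [t1'] at hy1'
      have hlt : hd (w ++ y) < k := by
        rw [hd_zero w y hy2]
        have := hd_le w
        omega
      have h2 := ih _ hlt _ _ hy1 rfl
      rw [hy1'] at h2
      have h3 := Option.some.inj h2
      obtain ⟨rfl, -⟩ := List.append_inj h3 (by omega)
      have he2 : e'.2 = e.2 := by omega
      unfold bz at e5
      rw [s1, s1'] at e5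
      simp only [List.getLast?_append, List.getLast?_singleton, Option.some_or, Option.elim_some,
        decide_eq_decide] at e5
      have cz : chain z = z.map Prod.fst := chain_zero z (fun x hx => nz x (by rw [a1]; simp [hx]) (a3 x hx))
      have cz' : chain z' = z'.map Prod.fst :=
        chain_zero z' (fun x hx => nz' x (by rw [b1]; simp [hx]) (b3 x hx))
      rw [a1, b1, List.append_assoc, List.append_assoc, chain_append w', chain_append w',
        List.append_cancel_left_eq, chain_append, chain_append, cz, cz'] at e1
      rw [a1, b1]
      by_cases h0 : e.1 = 0
      · have h0' := e5.2 h0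
        simp only [chain, List.map_cons, List.map_nil, h0, h0'] at e1
        have e6 : e' = e := by ext <;> omega
        rw [e6, zero_eq z' z b3 a3 (by simpa using e1)]
      · have h0' : e'.1 ≠ 0 := fun hh => h0 (e5.1 hh)
        have e7 : e'.1 :: z'.map Prod.fst = e.1 :: z.map Prod.fst := by
          simpa [chain, h0, h0'] using e1
        obtain ⟨e8, e9⟩ := List.cons.inj e7
        have e6 : e' = e := by ext <;> omega
        rw [e6, zero_eq z' z b3 a3 e9]

lemma enc_inj {f f' : Conf Q} (hf : Inv K N f) (hf' : Inv K N f') (h : enc f = enc f') : f = f' := by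
  funext q
  cases hq : f q with
  | some l => exact (enc_inj_aux hf hf' (fun q => congrFun h q) _ q l hq rfl).symm
  | none =>
    cases hq' : f' q with
    | none => rfl
    | some l =>
      have := enc_inj_aux hf' hf (fun q => congrFun h.symm q) _ q l hq' rfl
      rw [hq] at this; cases this

lemma enc_mem [DecidableEq Q] {f : Conf Q} (hN : 0 < N) (hf : Inv K N f) (F : Finset (List ℕ))
    (hF : ∀ l, vch K Finset.univ l → l ∈ F) (L : ℕ) (hL : K.dep Finset.univ + N ≤ L) :
    enc f ∈ Fintype.piFinset (fun _ : Q => Finset.insertNone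
      (F ×ˢ (Finset.univ : Finset Q) ×ˢ Finset.range (L + 1) ×ˢ Finset.range N ×ˢ (Finset.univ : Finset Bool))) := by
  classical
  rw [Fintype.mem_piFinset]
  intro q
  rw [Finset.mem_insertNone]
  intro a ha
  obtain ⟨l, hl, rfl⟩ := Option.map_eq_some_iff.1 ha
  simp only [Finset.mem_product, Finset.mem_univ, Finset.mem_range, and_true, true_and]
  refine ⟨hF _ (chain_vch K _ l (hf.val q l hl)), ?_, lst_lt hf hN ⟨q, l, hl, List.prefix_refl _⟩⟩
  have h1 := hd_le l
  have h2 := length_le hf hl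
  omega

/-- deterministic states -/
def DS (K : Skel Q) (N L : ℕ) : Type :=
  {x : Conf Q × (Q → ℕ) × (Q → ℕ) // Inv K N x.1 ∧ (∀ q, x.2.1 q ≤ L) ∧ (∀ q, x.2.2 q ≤ L)}

lemma DS_card (hK : Good K) (hN : 0 < N) (hn : N = Fintype.card Q) (L : ℕ)
    (hL : K.dep Finset.univ + N ≤ L) :
    Finite (DS K N L) ∧ Nat.card (DS K N L) ≤
      (N.factorial * (N * ((L + 1) * (N * 2))) + 1) ^ N * ((L + 1) ^ N * (L + 1) ^ N) := by
  classical
  obtain ⟨F, hF, hFc⟩ := chains_card K hK Finset.univ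
  let T := (Fintype.piFinset (fun _ : Q => Finset.insertNone
      (F ×ˢ (Finset.univ : Finset Q) ×ˢ Finset.range (L + 1) ×ˢ Finset.range N ×ˢ (Finset.univ : Finset Bool))))
      ×ˢ (Fintype.piFinset (fun _ : Q => Finset.range (L + 1))) ×ˢ
      (Fintype.piFinset (fun _ : Q => Finset.range (L + 1)))
  let φ : DS K N L → T := fun x => ⟨(enc x.1.1, x.1.2.1, x.1.2.2), by
    rw [Finset.mem_product, Finset.mem_product]
    refine ⟨enc_mem hN x.2.1 F hF L hL, ?_, ?_⟩
    · rw [Fintype.mem_piFinset]; intro q; rw [Finset.mem_range]; exact Nat.lt_succ_of_le (x.2.2.1 q)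
    · rw [Fintype.mem_piFinset]; intro q; rw [Finset.mem_range]; exact Nat.lt_succ_of_le (x.2.2.2 q)⟩
  have hφ : Function.Injective φ := by
    rintro ⟨⟨f, a, b⟩, h1, h2⟩ ⟨⟨f', a', b'⟩, h1', h2'⟩ h
    have h := congrArg Subtype.val h
    simp only [φ, Prod.mk.injEq] at h
    obtain ⟨e1, rfl, rfl⟩ := h
    obtain rfl := enc_inj h1 h1' e1
    rfl
  refine ⟨Finite.of_injective φ hφ, ?_⟩
  have h1 := Nat.card_le_card_of_injective φ hφ
  have h2 : Nat.card T = T.card := by simp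
  rw [h2] at h1
  refine h1.trans ?_
  simp only [T, Finset.card_product, Fintype.card_piFinset, Finset.card_insertNone, Finset.prod_const,
    Finset.card_univ, Finset.card_range, Fintype.card_bool, ← hn]
  gcongr
  rw [Finset.card_univ, ← hn] at hFc
  exact hFc

end SD

namespace SD
variable {Q : Type} {k : ℕ}

section skel
open Classical
variable (G B : Fin k → Set Q)

noncomputable def act (S : Finset Q) : Finset (Fin k) :=
  Finset.univ.filter (fun i => ∃ x ∈ S, x ∈ G i)
noncomputable def fam (S : Finset Q) : Finset (Finset Q) :=
  (act G S).image (fun i => S.filter (· ∈ B i))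
noncomputable def chs (S : Finset Q) : Finset (Finset Q) :=
  (fam G B S).filter (fun b => ∀ b' ∈ fam G B S, b' ⊆ b → b' = b)
noncomputable def bet (S : Finset Q) (j : ℕ) : Finset Q := (chs G B S).toList.getD (j - 1) ∅
noncomputable def nxs (S : Finset Q) (j : ℕ) : Finset Q :=
  if j = 0 then S else S.filter (fun x => x ∉ bet G B S j ∧
    ¬ ∃ i, x ∈ G i ∧ S.filter (· ∈ B i) ⊆ bet G B S j)

lemma bet_mem (S : Finset Q) (j : ℕ) (h0 : j ≠ 0) (hj : j ≤ (chs G B S).toList.length) :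
    bet G B S j ∈ chs G B S := by
  unfold bet
  rw [← Finset.mem_toList, List.getD_eq_getElem _ _ (by omega)]
  exact List.getElem_mem _

lemma bet_surj (S : Finset Q) (b : Finset Q) (hb : b ∈ chs G B S) :
    ∃ j, j ≠ 0 ∧ j ≤ (chs G B S).toList.length ∧ bet G B S j = b := by
  rw [← Finset.mem_toList] at hb
  obtain ⟨i, hi, rfl⟩ := List.getElem_of_mem hb
  refine ⟨i + 1, by omega, by omega, ?_⟩
  unfold bet
  rw [Nat.add_sub_cancel, List.getD_eq_getElem _ _ hi]

lemma bet_act (S : Finset Q) (j : ℕ) (h0 : j ≠ 0) (hj : j ≤ (chs G B S).toList.length) :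
    ∃ i ∈ act G S, S.filter (· ∈ B i) = bet G B S j := by
  have := bet_mem G B S j h0 hj
  exact Finset.mem_image.1 (Finset.mem_filter.1 this).1

lemma nxs_sub (S : Finset Q) (j : ℕ) : nxs G B S j ⊆ S := by
  unfold nxs
  split_ifs
  · exact Finset.Subset.refl _
  · exact Finset.filter_subset _ _

noncomputable def sk : Skel Q where
  r S := (chs G B S).toList.length
  β := bet G B
  nx := nxs G B
  dep S := min S.card (act G S).card
  nx_zero S := by simp [nxs]
  nx_sub := nxs_sub G B
  dep_lt := by
    intro S j h0 hj
    obtain ⟨i, hi, hb⟩ := bet_act G B S j h0 hj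
    obtain ⟨x, hx, hxG⟩ := (Finset.mem_filter.1 hi).2
    have key : ∀ y ∈ nxs G B S j, y ∉ G i := by
      intro y hy hyG
      rw [nxs, if_neg h0, Finset.mem_filter] at hy
      exact hy.2.2 ⟨i, hyG, hb.subset⟩
    have h1 : (nxs G B S j).card < S.card := by
      apply Finset.card_lt_card
      refine ⟨nxs_sub G B S j, fun h => key x (h hx) hxG⟩
    have h2 : (act G (nxs G B S j)).card < (act G S).card := by
      apply Finset.card_lt_card
      refine ⟨?_, ?_⟩
      · intro a ha
        obtain ⟨y, hy, hyG⟩ := (Finset.mem_filter.1 ha).2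
        exact Finset.mem_filter.2 ⟨Finset.mem_univ _, y, nxs_sub G B S j hy, hyG⟩
      · intro h
        obtain ⟨y, hy, hyG⟩ := (Finset.mem_filter.1 (h hi)).2
        exact key y hy hyG
    omega

lemma sk_good : Good (sk G B) where
  bsub := by
    intro S j h0 hj
    obtain ⟨i, hi, hb⟩ := bet_act G B S j h0 hj
    change bet G B S j ⊆ S
    rw [← hb]; exact Finset.filter_subset _ _
  dis := by
    intro S j h0 hj q hq hq'
    change q ∈ nxs G B S j at hq'
    rw [nxs, if_neg h0, Finset.mem_filter] at hq'
    exact hq'.2.1 hq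
  anti := by
    intro S i j hi0 hi hj0 hj h
    have h1 := bet_mem G B S i hi0 hi
    have h2 := bet_mem G B S j hj0 hj
    have h3 : bet G B S i = bet G B S j :=
      (Finset.mem_filter.1 h2).2 _ (Finset.mem_filter.1 h1).1 h
    change i ≤ (chs G B S).toList.length at hi
    change j ≤ (chs G B S).toList.length at hj
    unfold bet at h3
    rw [List.getD_eq_getElem _ _ (by omega), List.getD_eq_getElem _ _ (by omega)] at h3
    have := (Finset.nodup_toList (chs G B S)).getElem_inj_iff.1 h3
    omega

lemma sk_dep [Fintype Q] : (sk G B).dep Finset.univ ≤ min (Fintype.card Q) k := by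
  change min _ _ ≤ _
  apply min_le_min
  · exact Finset.card_le_univ _
  · exact (Finset.card_le_univ _).trans (by simp)

lemma sk_sound (S : Finset Q) (X : Set Q) (hX : X ⊆ ↑S)
    (h : ∀ j, j ≠ 0 → j ≤ (sk G B).r S → (X ∩ ↑((sk G B).β S j)).Nonempty) (i : Fin k)
    (hi : (X ∩ G i).Nonempty) : (X ∩ B i).Nonempty := by
  obtain ⟨x, hx, hxG⟩ := hi
  have h1 : S.filter (· ∈ B i) ∈ fam G B S :=
    Finset.mem_image.2 ⟨i, Finset.mem_filter.2 ⟨Finset.mem_univ _, x, hX hx, hxG⟩, rfl⟩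
  obtain ⟨b, hb, hbm⟩ : ∃ b ≤ S.filter (· ∈ B i), Minimal (· ∈ fam G B S) b :=
    Finset.exists_le_minimal _ h1
  have h2 : b ∈ chs G B S := Finset.mem_filter.2 ⟨hbm.1, fun b' hb' hs =>
    Finset.Subset.antisymm hs (hbm.2 hb' hs)⟩
  obtain ⟨j, hj0, hj, rfl⟩ := bet_surj G B S b h2
  obtain ⟨y, hy, hyb⟩ := h j hj0 hj
  exact ⟨y, hy, (Finset.mem_filter.1 (hb hyb)).2⟩

lemma sk_complete (S : Finset Q) (X : Set Q) (hX : X ⊆ ↑S)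
    (hacc : ∀ i, (X ∩ G i).Nonempty → (X ∩ B i).Nonempty) (j : ℕ) (h0 : j ≠ 0)
    (hb : ∀ x ∈ X, x ∉ (sk G B).β S j) : ∀ x ∈ X, x ∈ (sk G B).nx S j := by
  intro x hx
  change x ∈ nxs G B S j
  rw [nxs, if_neg h0, Finset.mem_filter]
  refine ⟨hX hx, hb x hx, ?_⟩
  rintro ⟨i, hi, hs⟩
  obtain ⟨y, hy, hyB⟩ := hacc i ⟨x, hx, hi⟩
  exact hb y hy (hs (Finset.mem_filter.2 ⟨hX hy, hyB⟩))

end skel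
end SD

namespace SD

lemma ratio_le (n : ℕ) : ((n : ℝ) / (n + 1)) ^ (n + 1) ≤ 0.37 := by
  have h := Real.one_sub_div_pow_le_exp_neg (n := n + 1) (t := 1) (by push_cast; linarith [Nat.cast_nonneg (α := ℝ) n])
  have h1 : (1 - 1 / ((n + 1 : ℕ) : ℝ)) = (n : ℝ) / (n + 1) := by
    push_cast
    field_simp
    ring
  rw [h1] at h
  refine h.trans ?_
  rw [Real.exp_neg, inv_le_comm₀ (Real.exp_pos 1) (by norm_num)]
  have := Real.exp_one_gt_d9
  norm_num at this ⊢
  linarith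

lemma fact_bound (n : ℕ) (hn : 1 ≤ n) : (n.factorial : ℝ) ≤ 3 * n * (0.37 * n) ^ n := by
  induction n, hn using Nat.le_induction with
  | base => norm_num
  | succ n hn ih =>
    rw [Nat.factorial_succ]
    push_cast
    have h1 := ratio_le n
    have h2 : (n : ℝ) ^ (n + 1) ≤ 0.37 * (n + 1 : ℝ) ^ (n + 1) := by
      rw [div_pow, div_le_iff₀ (by positivity)] at h1
      exact h1
    have h3 : (n : ℝ) * (0.37 * n) ^ n ≤ (0.37 * (n + 1)) ^ (n + 1) := by
      calc (n : ℝ) * (0.37 * n) ^ n = 0.37 ^ n * (n : ℝ) ^ (n + 1) := by rw [mul_pow]; ring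
        _ ≤ 0.37 ^ n * (0.37 * (n + 1 : ℝ) ^ (n + 1)) := by gcongr
        _ = _ := by rw [mul_pow]; ring
    calc ((n : ℝ) + 1) * n.factorial ≤ (n + 1) * (3 * n * (0.37 * n) ^ n) := by gcongr
      _ = 3 * (n + 1) * (n * (0.37 * n) ^ n) := by ring
      _ ≤ _ := by gcongr

lemma numeric (n : ℕ) (hn : 20 ≤ n) :
    (((n.factorial * (n * ((2 * n + 1) * (n * 2))) + 1) ^ n * ((2 * n + 1) ^ n * (2 * n + 1) ^ n) : ℕ) : ℝ)
      ≤ 2 ^ (12 * n) * (0.37 * (n : ℝ)) ^ (n ^ 2 + 8 * n) := by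
  have hn' : (20 : ℝ) ≤ n := by exact_mod_cast hn
  have hf := fact_bound n (by omega)
  have hf1 : (1 : ℝ) ≤ n.factorial := by exact_mod_cast Nat.factorial_pos n
  set A : ℝ := (n.factorial : ℝ) with hA
  set P : ℝ := (0.37 * (n : ℝ)) ^ n with hP
  have hPpos : 0 < P := by positivity
  have e1 : (2 : ℝ) ^ (12 * n) * (0.37 * (n : ℝ)) ^ (n ^ 2 + 8 * n) =
      (4096 * (P * (0.37 * (n : ℝ)) ^ 8)) ^ n := by
    rw [hP, ← pow_add, mul_pow (4096 : ℝ) _ n, ← pow_mul, pow_mul (2 : ℝ) 12 n]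
    congr 1
    · norm_num
    · congr 1; ring
  rw [e1]
  push_cast
  rw [← mul_pow, ← mul_pow]
  apply pow_le_pow_left₀ (by positivity)
  have h3 : (2 * (n : ℝ) + 1) ≤ 3 * n := by linarith
  have hn3 : (1 : ℝ) ≤ (n : ℝ) ^ 3 := one_le_pow₀ (by linarith)
  have h4 : A * (n * ((2 * n + 1) * (n * 2))) + 1 ≤ 7 * n ^ 3 * A := by
    have h5 : A * (n * ((2 * n + 1) * (n * 2))) ≤ A * (n * ((3 * n) * (n * 2))) := by gcongr
    have h6 : (1 : ℝ) ≤ n ^ 3 * A := one_le_mul_of_one_le_of_one_le hn3 hf1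
    nlinarith
  calc (A * (n * ((2 * n + 1) * (n * 2))) + 1) * ((2 * n + 1) * (2 * n + 1))
      ≤ (7 * n ^ 3 * (3 * n * P)) * ((3 * n) * (3 * n)) := by
        gcongr
        exact h4.trans (by gcongr)
    _ = (189 * n ^ 6) * P := by ring
    _ ≤ (4096 * 0.37 ^ 8 * n ^ 8) * P := by
        have : (189 : ℝ) ≤ 4096 * 0.37 ^ 8 * n ^ 2 := by nlinarith
        refine mul_le_mul_of_nonneg_right ?_ hPpos.le
        calc (189 : ℝ) * n ^ 6 ≤ (4096 * 0.37 ^ 8 * n ^ 2) * n ^ 6 := by gcongr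
          _ = _ := by ring
    _ = _ := by rw [mul_pow]; ring
end SD

namespace SD
variable {Q : Type}

lemma inf_meet {X : Type} [Finite X] (ρ : ℕ → X) (S : Set X) :
    (InfStates ρ ∩ S).Nonempty ↔ ∀ M, ∃ i ≥ M, ρ i ∈ S := by
  constructor
  · rintro ⟨x, hx, hS⟩ M
    obtain ⟨m, hm, rfl⟩ := hx M
    exact ⟨m, hm, hS⟩
  · intro h
    by_contra hc
    have h1 : ∀ x : X, ∃ M, x ∈ S → ∀ m ≥ M, ρ m ≠ x := by
      intro x
      by_contra hx
      push Not at hx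
      apply hc
      refine ⟨x, fun N => ?_, (hx 0).1⟩
      obtain ⟨_, m, h2, h3⟩ := hx N
      exact ⟨m, h2, h3⟩
    choose M hM using h1
    obtain ⟨b, hb⟩ := (Set.finite_range M).bddAbove
    obtain ⟨i, hi, hiS⟩ := h b
    exact hM _ hiS i ((hb ⟨ρ i, rfl⟩).trans hi) rfl

lemma inf_empty {X : Type} [Finite X] (ρ : ℕ → X) (S : Set X) :
    InfStates ρ ∩ S = ∅ ↔ ∃ M, ∀ i ≥ M, ρ i ∉ S := by
  rw [← Set.not_nonempty_iff_eq_empty, inf_meet]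
  push Not
  rfl

lemma inf_ev {X : Type} [Finite X] (ρ : ℕ → X) : ∃ M, ∀ i ≥ M, ρ i ∈ InfStates ρ := by
  have h := (inf_empty ρ (InfStates ρ)ᶜ).1 (by simp)
  obtain ⟨M, hM⟩ := h
  exact ⟨M, fun i hi => by simpa using hM i hi⟩

lemma inf_sub {X : Type} (ρ : ℕ → X) (S : Set X) (h : ∃ M, ∀ i ≥ M, ρ i ∈ S) :
    InfStates ρ ⊆ S := by
  obtain ⟨M, hM⟩ := h
  intro x hx
  obtain ⟨m, h1, rfl⟩ := hx M
  exact hM m h1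

variable [Fintype Q]

open Classical in
noncomputable def f0 (K : Skel Q) (Q₀ : Set Q) : Conf Q := fun q =>
  if q ∈ Q₀ then some (zext K Finset.univ) else none

lemma f0_some {K : Skel Q} {Q₀ : Set Q} {q : Q} {l : Code} (h : f0 K Q₀ q = some l) :
    q ∈ Q₀ ∧ l = zext K Finset.univ := by
  unfold f0 at h
  split_ifs at h with h1
  exact ⟨h1, (Option.some.inj h).symm⟩

lemma f0_nd {K : Skel Q} {Q₀ : Set Q} {u : Code} {e : ℕ × ℕ} (h : nd (f0 K Q₀) (u ++ [e])) :
    u ++ [e] <+: zext K Finset.univ ∧ e.2 = 0 ∧ e.1 ≠ 0 := by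
  obtain ⟨q, l, h1, h2⟩ := h
  obtain ⟨_, rfl⟩ := f0_some h1
  exact ⟨h2, (zext_spec K _).2 e (h2.subset (by simp))⟩

lemma f0_inv (K : Skel Q) (Q₀ : Set Q) {N : ℕ} (hN : 0 < N) : Inv K N (f0 K Q₀) where
  val q l h := by
    obtain ⟨_, rfl⟩ := f0_some h
    exact (zext_spec K _).1
  uniq u e u' e' h _ _ h0 := absurd (f0_nd h).2.1 h0
  z1 u e h _ := (f0_nd h).2.2
  z2 u e e' h h' _ _ := snoc_prefix_eq (f0_nd h).1 (f0_nd h').1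
  ext p h := by
    obtain ⟨q, l, h1, z, h2⟩ := h
    obtain ⟨_, h3⟩ := f0_some h1
    refine ⟨q, z, by rw [h1, h2], fun e he => ((zext_spec K Finset.univ).2 e ?_).1⟩
    rw [← h3, ← h2]
    simp [he]
  lt u e h := by rw [(f0_nd h).2.1]; exact hN

lemma stq_le (K : Skel Q) (g : Conf Q) (q : Q) : stq K g q ≤ flq g q := by
  classical
  exact Nat.findGreatest_le _

lemma flq_le {K : Skel Q} {g : Conf Q} {N : ℕ} (hg : PreInv K g) (hi : Inv K N (F3 (F2 K g)))
    (q : Q) : flq g q ≤ K.dep Finset.univ + N := by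
  rcases h : g q with _ | c
  · simp [flq, h]
  · have h1 := length_le hi (next_some (K := K) h)
    rw [norm_length] at h1
    have h2 := fll_le hg h
    have h3 : flq g q = fll g c := by simp [flq, h]
    simp at h1
    omega

lemma mainDS {α : Type} {k : ℕ} (n : ℕ) (hn : n = Fintype.card Q) (h0 : 0 < n)
    (Q₀ : Set Q) (Δ : Q → α → Q → Prop) (G B : Fin k → Set Q) :
    ∃ (init : DS (sk G B) n (2 * n)) (δ : DS (sk G B) n (2 * n) → α → DS (sk G B) n (2 * n))
      (G' B' : Fin n × Fin (min n k + 1) → Set (DS (sk G B) n (2 * n))),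
      ∀ w : ℕ → α,
          (∃ ρ : ℕ → Q, ρ 0 ∈ Q₀ ∧ (∀ i : ℕ, Δ (ρ i) (w i) (ρ (i + 1))) ∧
            ∀ i : Fin k, (InfStates ρ ∩ G i).Nonempty → (InfStates ρ ∩ B i).Nonempty) ↔
          (∃ ρ : ℕ → DS (sk G B) n (2 * n), ρ 0 = init ∧ (∀ i : ℕ, ρ (i + 1) = δ (ρ i) (w i)) ∧
            ∃ x, (∀ M, ∃ i ≥ M, ρ i ∈ G' x) ∧ ∃ M, ∀ i ≥ M, ρ i ∉ B' x) := by
  set K := sk G B with hK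
  let ν : Q → ℕ := fun q => n + (Fintype.equivFin Q q : ℕ)
  have hν : ∀ q, n ≤ ν q := fun q => Nat.le_add_right _ _
  have hinj : Function.Injective ν := by
    intro a b h
    apply (Fintype.equivFin Q).injective
    apply Fin.ext
    simp only [ν] at h
    omega
  have hdep : K.dep Finset.univ ≤ min n k := by rw [hn]; exact sk_dep G B
  have hdn : K.dep Finset.univ + n ≤ 2 * n := by have := min_le_left n k; omega
  have hpre : ∀ (f : Conf Q) (R : Q → Q → Prop), Inv K n f → PreInv K (F1 K ν R f) :=
    fun f R hf => F1_inv hf hν h0 hinj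
  have hnext : ∀ (f : Conf Q) (R : Q → Q → Prop), Inv K n f → Inv K n (F3 (F2 K (F1 K ν R f))) :=
    fun f R hf => next_inv hn hf hν h0 hinj
  let init : DS K n (2 * n) := ⟨(f0 K Q₀, fun _ => 0, fun _ => 0), f0_inv K Q₀ h0,
    fun _ => Nat.zero_le _, fun _ => Nat.zero_le _⟩
  let gg : DS K n (2 * n) → α → Conf Q := fun x a => F1 K ν (fun q q' => Δ q a q') x.1.1
  let δ : DS K n (2 * n) → α → DS K n (2 * n) := fun x a =>
    ⟨(F3 (F2 K (gg x a)), stq K (gg x a), flq (gg x a)), hnext _ _ x.2.1,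
      fun q => (stq_le K _ q).trans ((flq_le (hpre _ _ x.2.1) (hnext _ _ x.2.1) q).trans hdn),
      fun q => (flq_le (hpre _ _ x.2.1) (hnext _ _ x.2.1) q).trans hdn⟩
  let G' : Fin n × Fin (min n k + 1) → Set (DS K n (2 * n)) := fun y =>
    {x | ∃ q l, x.1.1 q = some l ∧ lst (l.take (x.1.2.2 q)) = y.1 ∧ lev (l.take (x.1.2.2 q)) = y.2}
  let B' : Fin n × Fin (min n k + 1) → Set (DS K n (2 * n)) := fun y =>
    {x | ¬ ∃ q l p, x.1.1 q = some l ∧ p <+: l ∧ p.length ≤ x.1.2.1 q ∧ lst p = y.1 ∧ lev p = y.2}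
  refine ⟨init, δ, G', B', fun w => ?_⟩
  let ρD : ℕ → DS K n (2 * n) := fun i => Nat.rec init (fun i x => δ x (w i)) i
  have hρ0 : ρD 0 = init := rfl
  have hρs : ∀ i, ρD (i + 1) = δ (ρD i) (w i) := fun i => rfl
  let f : ℕ → Conf Q := fun i => (ρD i).1.1
  let R : ℕ → Q → Q → Prop := fun i q q' => Δ q (w i) q'
  have hRn : Rn K n ν R f := ⟨fun i => rfl, fun i => (ρD i).2.1, hν, fun i => hpre _ _ (ρD i).2.1⟩
  have hst : ∀ i, (ρD (i + 1)).1.2.1 = stq K (F1 K ν (R i) (f i)) := fun i => rfl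
  have hfl : ∀ i, (ρD (i + 1)).1.2.2 = flq (F1 K ν (R i) (f i)) := fun i => rfl
  have hunique : ∀ ρ : ℕ → DS K n (2 * n), ρ 0 = init → (∀ i, ρ (i + 1) = δ (ρ i) (w i)) → ρ = ρD := by
    intro ρ h1 h2
    funext i
    induction i with
    | zero => exact h1
    | succ i ih => rw [h2, ih, hρs]
  have hB : ∀ y i, ρD (i + 1) ∉ B' y ↔ ∃ q p, stab K (F1 K ν (R i) (f i)) p q ∧
      lst p = (y.1 : ℕ) ∧ lev p = (y.2 : ℕ) := by
    intro y i
    simp only [B', Set.mem_ofPred_eq, not_not, hst]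
    constructor
    · rintro ⟨q, l, p, h1, h2, h3, h4, h5⟩
      exact ⟨q, p, (stab_iff (hRn.pre i) h1 h2).2 h3, h4, h5⟩
    · rintro ⟨q, p, h1, h4, h5⟩
      obtain ⟨c, d, h6, h7, h8, h9, h10⟩ := id h1
      exact ⟨q, d, p, h7, h10, (stab_iff (hRn.pre i) h7 h10).1 h1, h4, h5⟩
  have hacc : AccD K ν R f ↔ ∃ x, (∀ M, ∃ i ≥ M, ρD i ∈ G' x) ∧ ∃ M, ∀ i ≥ M, ρD i ∉ B' x := by
    constructor
    · rintro ⟨c, t, h1, M, h2⟩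
      obtain ⟨i, _, q, l, h3, h4, h5⟩ := h1 0
      have hc : c < n := by
        rw [← h4]
        exact lst_lt (hRn.inv (i + 1)) h0 ⟨q, l, h3, List.take_prefix _ _⟩
      have ht : t < min n k + 1 := by
        rw [← h5]
        have a := lev_mono (List.take_prefix (flq (F1 K ν (R i) (f i)) q) l)
        have b := lev_le_dep _ l ((hRn.inv (i + 1)).val q l h3)
        omega
      refine ⟨(⟨c, hc⟩, ⟨t, ht⟩), ?_, M + 1, ?_⟩
      · intro M
        obtain ⟨i, hi, q, l, h3, h4, h5⟩ := h1 M
        exact ⟨i + 1, by omega, q, l, h3, h4, h5⟩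
      · intro i hi
        obtain ⟨i, rfl⟩ : ∃ j, i = j + 1 := ⟨i - 1, by omega⟩
        exact (hB _ i).2 (h2 i (by omega))
    · rintro ⟨y, h1, M, h2⟩
      refine ⟨y.1, y.2, ?_, M, ?_⟩
      · intro M
        obtain ⟨i, hi, q, l, h3, h4, h5⟩ := h1 (M + 1)
        obtain ⟨i, rfl⟩ : ∃ j, i = j + 1 := ⟨i - 1, by omega⟩
        exact ⟨i, by omega, q, l, h3, h4, h5⟩
      · intro i hi
        exact (hB _ i).1 (h2 (i + 1) (by omega))
  have hgood := sk_good G B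
  constructor
  · rintro ⟨ρ, h1, h2, h3⟩
    refine ⟨ρD, hρ0, hρs, hacc.1 ?_⟩
    refine completeness hRn ?_ ρ ⟨zext K Finset.univ, ?_⟩ h2 ?_
    · exact hgood.dis
    · change f0 K Q₀ (ρ 0) = _
      simp [f0, h1]
    · intro S j hj hjr hS hb
      obtain ⟨M, hM⟩ := inf_ev ρ
      refine ⟨M, fun i hi => ?_⟩
      refine sk_complete G B S (InfStates ρ) (inf_sub ρ _ hS) h3 j hj ?_ _ (hM i hi)
      exact fun x hx => inf_sub ρ {x | x ∉ K.β S j} hb hx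
  · rintro ⟨ρ, h1, h2, h3⟩
    obtain rfl := hunique ρ h1 h2
    obtain ⟨ρ, S, ⟨l, a1⟩, a2, a3, a4⟩ := soundness hRn (hacc.2 h3)
    refine ⟨ρ, (f0_some a1).1, a2, fun i hi => ?_⟩
    refine sk_sound G B S (InfStates ρ) (inf_sub ρ _ a3) ?_ i hi
    intro j hj hjr
    exact (inf_meet ρ _).2 (a4 j hj hjr)

end SD

theorem streett_determinization_absolute_bound :
    ∃ n₀ : ℕ, ∀ (α Q : Type) (_ : Fintype α) (_ : Nonempty α) (_ : Fintype Q)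
      (n k : ℕ), Fintype.card Q = n → n₀ ≤ n → 1 ≤ k →
      ∀ (Q₀ : Set Q) (Δ : Q → α → Q → Prop) (G B : Fin k → Set Q),
      ∃ (m kB : ℕ) (init : Fin m) (δ : Fin m → α → Fin m)
        (G' B' : Fin kB → Set (Fin m)),
        (m : ℝ) ≤ 2 ^ (12 * n) * (0.37 * (n : ℝ)) ^ (n ^ 2 + 8 * n) ∧
        kB ≤ n * (min n k + 1) ∧
        ∀ w : ℕ → α,
          (∃ ρ : ℕ → Q, ρ 0 ∈ Q₀ ∧ (∀ i : ℕ, Δ (ρ i) (w i) (ρ (i + 1))) ∧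
            ∀ i : Fin k, (InfStates ρ ∩ G i).Nonempty → (InfStates ρ ∩ B i).Nonempty) ↔
          (∃ ρ : ℕ → Fin m, ρ 0 = init ∧ (∀ i : ℕ, ρ (i + 1) = δ (ρ i) (w i)) ∧
            ∃ i : Fin kB, (InfStates ρ ∩ G' i).Nonempty ∧ InfStates ρ ∩ B' i = ∅) := by
  refine ⟨20, ?_⟩
  intro α Q _ _ _ n k hn h20 hk Q₀ Δ G B
  have hdep : (SD.sk G B).dep Finset.univ ≤ min n k := by rw [← hn]; exact SD.sk_dep G B
  have hdn : (SD.sk G B).dep Finset.univ + n ≤ 2 * n := by have := min_le_left n k; omega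
  obtain ⟨hfin, hcard⟩ := SD.DS_card (SD.sk_good G B) (N := n) (by omega) hn.symm (2 * n) hdn
  obtain ⟨init, δ, G', B', hmain⟩ := SD.mainDS n hn.symm (by omega) Q₀ Δ G B
  let e := Finite.equivFin (SD.DS (SD.sk G B) n (2 * n))
  let p : Fin n × Fin (min n k + 1) ≃ Fin (n * (min n k + 1)) := finProdFinEquiv
  refine ⟨Nat.card (SD.DS (SD.sk G B) n (2 * n)), n * (min n k + 1), e init,
    fun x a => e (δ (e.symm x) a), fun i => e.symm ⁻¹' G' (p.symm i),
    fun i => e.symm ⁻¹' B' (p.symm i), ?_, le_rfl, fun w => ?_⟩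
  · exact (Nat.cast_le.2 hcard).trans (SD.numeric n h20)
  · rw [hmain w]
    constructor
    · rintro ⟨ρ, h1, h2, x, h3, h4⟩
      refine ⟨fun i => e (ρ i), congrArg e h1, fun i => by simp [h2], p x, ?_, ?_⟩
      · rw [SD.inf_meet]; simpa using h3
      · rw [SD.inf_empty]; simpa using h4
    · rintro ⟨ρ, h1, h2, x, h3, h4⟩
      refine ⟨fun i => e.symm (ρ i), by simp [h1], fun i => by simp [h2], p.symm x, ?_, ?_⟩
      · rw [SD.inf_meet] at h3; simpa using h3
      · rw [SD.inf_empty] at h4; simpa using h4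
end
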